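/- arXiv:math/0509668 — 2 statements merged into one kernel-verified Lean document; each statement's English description precedes it below -/
import Mathlib

section
/- Let V : ℝ → ℝ be smooth with compact support contained in [0, L]. For each k ∈ ℝ, k ≠ 0, let f(·,k) be the Jost solution (the solution of −f'' + V f = k²f with f(x,k) = e^{ikx} for x ≥ L) and let a(k) be the unique coefficient with f(x,k) = a(k)e^{ikx} + b(k)e^{−ikx} for x ≤ 0. Let S be the set of negative energies E < 0 for which −u'' + V u = E u admits a nonzero twice continuously differentiable solution u with ∫_ℝ |u(x)|² dx < ∞ (the negative eigenvalues E_j of H_V). Then the sum rule identity holds: ∫_{−∞}^{∞} log|a(k)|·k² dk + (2π/3)·∑_{E ∈ S} |E|^{3/2} = (π/8)·∫_{−∞}^{∞} V(x)² dx, with all quantities finite. -/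
open Real Set MeasureTheory


lemma isUnit_of_pow_small {E : Type*} [NormedAddCommGroup E] [NormedSpace ℂ E] [CompleteSpace E]
    (T : E →L[ℂ] E) (n : ℕ) (hn : ‖T ^ n‖ < 1) : IsUnit (1 - T) := by
  have h1 : IsUnit (1 - T^n) := isUnit_one_sub_of_norm_lt_one hn
  have h2 : (1 - T) * (∑ i ∈ Finset.range n, T ^ i) = 1 - T^n := mul_neg_geom_sum _ _
  have h3 : (∑ i ∈ Finset.range n, T ^ i) * (1 - T) = 1 - T^n := geom_sum_mul_neg _ _
  have hc : Commute (1 - T) (∑ i ∈ Finset.range n, T ^ i) := by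
    rw [Commute, SemiconjBy, h2, h3]
  exact (hc.isUnit_mul_iff.1 (h2 ▸ h1)).1

lemma inverse_family_diff {E : Type*} [NormedAddCommGroup E] [NormedSpace ℂ E] [CompleteSpace E]
    (A B : E →L[ℂ] E) (h : ∀ k : ℂ, IsUnit (1 - (A + (2 * Complex.I * k) • B))) (y : E) :
    Differentiable ℂ (fun k : ℂ => Ring.inverse (1 - (A + (2 * Complex.I * k) • B)) y) := by
  have h1 : Differentiable ℂ (fun k : ℂ => 1 - (A + (2 * Complex.I * k) • B)) := by
    fun_prop
  have h2 : Differentiable ℂ (fun k : ℂ => Ring.inverse (1 - (A + (2 * Complex.I * k) • B))) := by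
    intro k
    exact DifferentiableAt.comp (f := fun k : ℂ => 1 - (A + (2 * Complex.I * k) • B)) k
      (differentiableAt_inverse (𝕜 := ℂ) (h k)) (h1 k)
  exact fun k => (h2 k).clm_apply (differentiableAt_const _)

noncomputable section JostOp
variable {L : ℝ}

/-- extension to the real line -/
def jext (hL : 0 ≤ L) (φ : C(Icc (0:ℝ) L, ℂ)) : ℝ → ℂ := Set.IccExtend hL φ

lemma jext_cont (hL : 0 ≤ L) (φ : C(Icc (0:ℝ) L, ℂ)) : Continuous (jext hL φ) :=
  φ.continuous.Icc_extend'

lemma jext_of_mem (hL : 0 ≤ L) (φ : C(Icc (0:ℝ) L, ℂ)) (x : Icc (0:ℝ) L) :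
    jext hL φ x = φ x := by
  simp [jext, Set.IccExtend_val]

lemma jext_norm_le (hL : 0 ≤ L) (φ : C(Icc (0:ℝ) L, ℂ)) (x : ℝ) : ‖jext hL φ x‖ ≤ ‖φ‖ := by
  unfold jext Set.IccExtend
  exact φ.norm_coe_le_norm _

lemma hasDerivAt_tail {w : ℝ → ℂ} (hw : Continuous w) (L x : ℝ) :
    HasDerivAt (fun y => ∫ t in y..L, w t) (-w x) x :=
  intervalIntegral.integral_hasDerivAt_left (hw.intervalIntegrable _ _)
    (hw.stronglyMeasurableAtFilter _ _) hw.continuousAt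

def JopFun (hL : 0 ≤ L) (φ : C(Icc (0:ℝ) L, ℂ)) : C(Icc (0:ℝ) L, ℂ) :=
  ⟨fun x => ∫ t in (x:ℝ)..L, jext hL φ t, by
    have : Continuous (fun y => ∫ t in y..L, jext hL φ t) :=
      continuous_iff_continuousAt.2 fun x => (hasDerivAt_tail (jext_cont hL φ) L x).continuousAt
    exact this.comp continuous_subtype_val⟩

lemma JopFun_apply (hL : 0 ≤ L) (φ : C(Icc (0:ℝ) L, ℂ)) (x : Icc (0:ℝ) L) :
    JopFun hL φ x = ∫ t in (x:ℝ)..L, jext hL φ t := rfl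

lemma JopFun_bound (hL : 0 ≤ L) (φ : C(Icc (0:ℝ) L, ℂ)) (n : ℕ) (D : ℝ)
    (h : ∀ x : Icc (0:ℝ) L, ‖φ x‖ ≤ D * (L - x) ^ n / n.factorial) (x : Icc (0:ℝ) L) :
    ‖JopFun hL φ x‖ ≤ D * (L - x) ^ (n+1) / (n+1).factorial := by
  rw [JopFun_apply]
  have h1 : ‖∫ t in (x:ℝ)..L, jext hL φ t‖ ≤ ∫ t in (x:ℝ)..L, D * (L - t) ^ n / n.factorial := by
    apply intervalIntegral.norm_integral_le_of_norm_le x.2.2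
    · refine Filter.Eventually.of_forall fun t ht => ?_
      have := h ⟨t, x.2.1.trans ht.1.le, ht.2⟩
      rwa [← jext_of_mem hL] at this
    · exact (by fun_prop : Continuous fun t : ℝ => D * (L - t) ^ n / n.factorial).intervalIntegrable _ _
  refine h1.trans (le_of_eq ?_)
  have : ∀ t ∈ uIcc (x:ℝ) L, HasDerivAt (fun t => - (D * (L - t) ^ (n+1) / (n+1).factorial))
      (D * (L - t) ^ n / n.factorial) t := by
    intro t _
    have h2 := ((((hasDerivAt_id t).const_sub L).pow (n+1)).const_mul D).div_const
      ((n+1).factorial : ℝ)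
    refine h2.neg.congr_deriv ?_
    have : (n.factorial : ℝ) ≠ 0 := by positivity
    rw [Nat.factorial_succ]; push_cast
    simp
    field_simp
  rw [intervalIntegral.integral_eq_sub_of_hasDerivAt this]
  · simp
  · exact (by fun_prop : Continuous fun t : ℝ => D * (L - t) ^ n / n.factorial).intervalIntegrable _ _

def Jop (hL : 0 ≤ L) : C(Icc (0:ℝ) L, ℂ) →L[ℂ] C(Icc (0:ℝ) L, ℂ) :=
  LinearMap.mkContinuous
    { toFun := JopFun hL
      map_add' := by
        intro φ ψ
        ext x
        simp only [JopFun_apply, ContinuousMap.add_apply]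
        rw [← intervalIntegral.integral_add ((jext_cont hL φ).intervalIntegrable _ _)
          ((jext_cont hL ψ).intervalIntegrable _ _)]
        rfl
      map_smul' := by
        intro c φ
        ext x
        simp only [JopFun_apply, ContinuousMap.smul_apply, RingHom.id_apply]
        rw [← intervalIntegral.integral_smul]
        rfl } L (by
      intro φ
      rw [ContinuousMap.norm_le _ (by positivity)]
      intro x
      have := JopFun_bound hL φ 0 ‖φ‖ (by intro x; simpa using φ.norm_coe_le_norm x) x
      simp at this
      have hx := x.2.1
      calc _ ≤ _ := this
        _ ≤ L * ‖φ‖ := by nlinarith [norm_nonneg φ])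

lemma Jop_apply (hL : 0 ≤ L) (φ : C(Icc (0:ℝ) L, ℂ)) : Jop hL φ = JopFun hL φ := rfl

/-- the Volterra operator -/
def TopJ (hL : 0 ≤ L) (v : C(Icc (0:ℝ) L, ℂ)) (k : ℂ) :
    C(Icc (0:ℝ) L, ℂ) →L[ℂ] C(Icc (0:ℝ) L, ℂ) :=
  Jop hL ∘L (ContinuousLinearMap.mul ℂ _ v) ∘L Jop hL + (2 * Complex.I * k) • Jop hL

lemma Top_pow_bound (hL : 0 ≤ L) (v : C(Icc (0:ℝ) L, ℂ)) (k : ℂ) (φ : C(Icc (0:ℝ) L, ℂ)) (n : ℕ) :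
    ∀ x : Icc (0:ℝ) L, ‖((TopJ hL v k)^n) φ x‖ ≤
      (‖φ‖ * (‖v‖ * L + 2 * ‖k‖) ^ n) * (L - x) ^ n / n.factorial := by
  induction n with
  | zero => intro x; simpa using φ.norm_coe_le_norm x
  | succ n ih =>
    set C := ‖v‖ * L + 2 * ‖k‖ with hC
    set ψ := ((TopJ hL v k)^n) φ with hψ
    have e : ((TopJ hL v k)^(n+1)) φ = JopFun hL (v * JopFun hL ψ + (2 * Complex.I * k) • ψ) := by
      rw [pow_succ']
      simp only [mul_apply_eq_comp, ← hψ]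
      simp only [TopJ, add_apply, ContinuousLinearMap.comp_apply,
        smul_apply, ← Jop_apply, map_add, map_smul]
      rfl
    rw [e]
    apply JopFun_bound
    intro x
    have h1 := JopFun_bound hL ψ n _ ih x
    have h2 := ih x
    have hx0 := x.2.1
    have hx1 : 0 ≤ L - x := sub_nonneg.2 x.2.2
    have h3 : ‖JopFun hL ψ x‖ ≤ L * (‖φ‖ * C ^ n * (L - x) ^ n / n.factorial) := by
      refine h1.trans ?_
      rw [Nat.factorial_succ, pow_succ (L - (x:ℝ))]; push_cast
      have hp : 0 ≤ ‖φ‖ * C ^ n * (L - x) ^ n / n.factorial := by positivity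
      have : ‖φ‖ * C ^ n * ((L - ↑x) ^ n * (L - ↑x)) / ((↑n + 1) * ↑n.factorial)
          = (‖φ‖ * C ^ n * (L - x) ^ n / n.factorial) * ((L - x) / (n + 1)) := by
        field_simp
      rw [this, mul_comm L]
      apply mul_le_mul_of_nonneg_left _ hp
      rw [div_le_iff₀ (by positivity)]
      nlinarith [(Nat.cast_nonneg n : (0:ℝ) ≤ n)]
    have hp : 0 ≤ ‖φ‖ * C ^ n * (L - x) ^ n / n.factorial := by positivity
    calc _ ≤ ‖v x‖ * ‖JopFun hL ψ x‖ + 2 * ‖k‖ * ‖ψ x‖ := by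
          simp only [ContinuousMap.add_apply, ContinuousMap.mul_apply, ContinuousMap.smul_apply]
          refine (norm_add_le _ _).trans ?_
          simp [norm_smul]
      _ ≤ ‖v‖ * (L * (‖φ‖ * C ^ n * (L - x) ^ n / n.factorial)) +
            2 * ‖k‖ * (‖φ‖ * C ^ n * (L - x) ^ n / n.factorial) := by
          gcongr
          exact v.norm_coe_le_norm x
      _ = _ := by rw [pow_succ, hC]; ring

lemma Top_isUnit (hL : 0 ≤ L) (v : C(Icc (0:ℝ) L, ℂ)) (k : ℂ) : IsUnit (1 - TopJ hL v k) := by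
  set C := ‖v‖ * L + 2 * ‖k‖ with hC
  have hC0 : 0 ≤ C := by positivity
  have ht := FloorSemiring.tendsto_pow_div_factorial_atTop (C * L)
  obtain ⟨n, hn⟩ := (ht.eventually (gt_mem_nhds (show (0:ℝ) < 1/2 by norm_num))).exists
  have hnorm : ‖(TopJ hL v k)^n‖ < 1 := by
    refine lt_of_le_of_lt (ContinuousLinearMap.opNorm_le_bound _ (by positivity) ?_)
      (show (1/2:ℝ) < 1 by norm_num)
    intro φ
    rw [ContinuousMap.norm_le _ (by positivity)]
    intro x
    have hx0 := x.2.1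
    have hx1 : 0 ≤ L - x := sub_nonneg.2 x.2.2
    calc _ ≤ _ := Top_pow_bound hL v k φ n x
      _ ≤ ‖φ‖ * C ^ n * L ^ n / n.factorial := by
          gcongr; linarith
      _ = (C * L) ^ n / n.factorial * ‖φ‖ := by rw [mul_pow]; ring
      _ ≤ _ := by gcongr
  exact isUnit_of_pow_small _ n hnorm

/-- The derivative of the normalized Jost solution on `[0,L]`. -/
def jsol (hL : 0 ≤ L) (v : C(Icc (0:ℝ) L, ℂ)) (k : ℂ) : C(Icc (0:ℝ) L, ℂ) :=
  Ring.inverse (1 - TopJ hL v k) (- Jop hL v)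

lemma jsol_eq (hL : 0 ≤ L) (v : C(Icc (0:ℝ) L, ℂ)) (k : ℂ) :
    jsol hL v k = - Jop hL (v * (1 - Jop hL (jsol hL v k)) - (2 * Complex.I * k) • jsol hL v k) := by
  have h : (1 - TopJ hL v k) (jsol hL v k) = - Jop hL v := by
    unfold jsol
    rw [← mul_apply_eq_comp, Ring.mul_inverse_cancel _ (Top_isUnit hL v k)]
    rfl
  simp only [sub_apply, TopJ, add_apply,
    ContinuousLinearMap.comp_apply, smul_apply,
    one_apply_eq_self, ContinuousLinearMap.mul_apply'] at h
  rw [mul_sub, mul_one, map_sub, map_sub, map_smul]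
  rw [sub_eq_iff_eq_add] at h
  conv_lhs => rw [h]
  abel

lemma jsol_diff (hL : 0 ≤ L) (v : C(Icc (0:ℝ) L, ℂ)) : Differentiable ℂ (jsol hL v) := by
  exact inverse_family_diff _ _ (fun k => Top_isUnit hL v k) _

end JostOp

theorem jost_exists (V : ℝ → ℝ) (hV : Continuous V) (L : ℝ) (hL : 0 < L)
    (hs : ∀ x, x ∉ Icc 0 L → V x = 0) :
    ∃ m p : ℂ → ℝ → ℂ, (∀ k x, HasDerivAt (m k) (p k x) x) ∧
      (∀ k x, HasDerivAt (p k) (V x * m k x - 2 * Complex.I * k * p k x) x) ∧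
      (∀ k, ∀ x ≥ L, m k x = 1 ∧ p k x = 0) ∧
      Differentiable ℂ (fun k => m k 0) ∧ Differentiable ℂ (fun k => p k 0) := by
  set v : C(Icc (0:ℝ) L, ℂ) := ⟨fun x => (V x : ℂ), by fun_prop⟩ with hv
  set q : ℂ → C(Icc (0:ℝ) L, ℂ) := jsol hL.le v with hq
  set w : ℂ → ℝ → ℂ := fun k t => V t * jext hL.le (1 - Jop hL.le (q k)) t with hw
  have hwc : ∀ k, Continuous (w k) := fun k =>
    (Complex.continuous_ofReal.comp hV).mul (jext_cont _ _)
  set P : ℂ → ℝ → ℂ := fun k x => -(Complex.exp (-(2 * Complex.I * k * x)) *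
    ∫ t in x..L, Complex.exp (2 * Complex.I * k * t) * w k t) with hP
  have hec : ∀ k : ℂ, Continuous (fun t : ℝ => Complex.exp (2 * Complex.I * k * t) * w k t) := fun k => by
    have := hwc k; fun_prop
  have hPd : ∀ k x, HasDerivAt (P k) (w k x - 2 * Complex.I * k * P k x) x := by
    intro k x
    have h1 := hasDerivAt_tail (hec k) L x
    have h2 : HasDerivAt (fun x : ℝ => Complex.exp (-(2 * Complex.I * k * x)))
        (Complex.exp (-(2 * Complex.I * k * x)) * (-(2 * Complex.I * k))) x := by
      have := ((Complex.ofRealCLM.hasDerivAt (x := x)).const_mul (2 * Complex.I * k)).neg.cexp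
      simpa using this
    have := (h2.mul h1).neg
    refine this.congr_deriv ?_
    simp only [hP]
    have he : Complex.exp (-(2 * Complex.I * k * x)) * Complex.exp (2 * Complex.I * k * x) = 1 := by
      rw [← Complex.exp_add]; simp
    linear_combination (w k x) * he
  have hPc : ∀ k, Continuous (P k) := fun k =>
    continuous_iff_continuousAt.2 fun x => (hPd k x).continuousAt
  have hPq : ∀ k, ∀ x : Icc (0:ℝ) L, P k x = q k x := by
    intro k x
    set R : ℝ → ℂ := fun x => -∫ t in x..L, (w k t - 2 * Complex.I * k * jext hL.le (q k) t) with hR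
    have hRc : Continuous (fun t => w k t - 2 * Complex.I * k * jext hL.le (q k) t) := by
      have := hwc k
      have := jext_cont hL.le (q k)
      fun_prop
    have hRd : ∀ y, HasDerivAt R (w k y - 2 * Complex.I * k * jext hL.le (q k) y) y := by
      intro y
      exact (hasDerivAt_tail hRc L y).neg.congr_deriv (neg_neg _)
    have hRq : ∀ y : Icc (0:ℝ) L, R y = q k y := by
      intro y
      have h1 := congrArg (fun φ : C(Icc (0:ℝ) L, ℂ) => φ y) (jsol_eq hL.le v k)
      simp only [← hq, ContinuousMap.neg_apply, Jop_apply, JopFun_apply] at h1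
      rw [h1]
      simp only [hR, neg_inj]
      apply intervalIntegral.integral_congr
      intro t ht
      rw [uIcc_of_le y.2.2] at ht
      have ht' : t ∈ Icc (0:ℝ) L := ⟨y.2.1.trans ht.1, ht.2⟩
      have e1 := jext_of_mem hL.le (1 - Jop hL.le (q k)) ⟨t, ht'⟩
      have e2 := jext_of_mem hL.le (q k) ⟨t, ht'⟩
      have e3 := jext_of_mem hL.le (v * (1 - Jop hL.le (q k)) - (2 * Complex.I * k) • (q k)) ⟨t, ht'⟩
      simp only [hw]
      rw [e1, e2]
      refine Eq.trans ?_ e3.symm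
      simp [hv]
    have key : ∫ t in (x:ℝ)..L, Complex.exp (2 * Complex.I * k * t) * w k t =
        Complex.exp (2 * Complex.I * k * L) * R L - Complex.exp (2 * Complex.I * k * x) * R x := by
      apply intervalIntegral.integral_eq_sub_of_hasDerivAt (f := fun t : ℝ => Complex.exp (2 * Complex.I * k * t) * R t)
      · intro t ht
        rw [uIcc_of_le x.2.2] at ht
        have ht' : t ∈ Icc (0:ℝ) L := ⟨x.2.1.trans ht.1, ht.2⟩
        have h2 : HasDerivAt (fun x : ℝ => Complex.exp ((2 * Complex.I * k * x)))
            (Complex.exp ((2 * Complex.I * k * t)) * ((2 * Complex.I * k))) t := by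
          have := ((Complex.ofRealCLM.hasDerivAt (x := t)).const_mul (2 * Complex.I * k)).cexp
          simpa using this
        refine (h2.mul (hRd t)).congr_deriv ?_
        have := hRq ⟨t, ht'⟩
        have e2 := jext_of_mem hL.le (q k) ⟨t, ht'⟩
        simp only at this e2
        rw [e2, this]
        ring
      · exact (hec k).intervalIntegrable _ _
    simp only [hP]
    rw [key, hRq]
    have : R L = 0 := by simp [hR]
    rw [this]
    have he : Complex.exp (-(2 * Complex.I * k * x)) * Complex.exp (2 * Complex.I * k * x) = 1 := by
      rw [← Complex.exp_add]; simp
    linear_combination (q k x) * he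
  set M : ℂ → ℝ → ℂ := fun k x => 1 - ∫ t in x..L, P k t with hM
  have hMd : ∀ k x, HasDerivAt (M k) (P k x) x := by
    intro k x
    have := (hasDerivAt_tail (hPc k) L x).const_sub 1
    simpa using this
  have hMq : ∀ k, ∀ x : Icc (0:ℝ) L, M k x = (1 - Jop hL.le (q k)) x := by
    intro k x
    simp only [hM, ContinuousMap.sub_apply, ContinuousMap.one_apply, Jop_apply, JopFun_apply]
    congr 1
    apply intervalIntegral.integral_congr
    intro t ht
    rw [uIcc_of_le x.2.2] at ht
    have ht' : t ∈ Icc (0:ℝ) L := ⟨x.2.1.trans ht.1, ht.2⟩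
    have e2 := jext_of_mem hL.le (q k) ⟨t, ht'⟩
    have := hPq k ⟨t, ht'⟩
    simp only at this e2 ⊢
    rw [e2, this]
  have hwM : ∀ k x, w k x = V x * M k x := by
    intro k x
    by_cases hx : x ∈ Icc 0 L
    · simp only [hw]
      have e1 := jext_of_mem hL.le (1 - Jop hL.le (q k)) ⟨x, hx⟩
      have e2 := hMq k ⟨x, hx⟩
      simp only at e1 e2
      rw [e1, e2]
    · simp [hw, hs x hx]
  have hPL : ∀ k, ∀ x ≥ L, P k x = 0 := by
    intro k x hx
    simp only [hP]
    have : ∫ t in x..L, Complex.exp (2 * Complex.I * k * t) * w k t = ∫ t in x..L, (0:ℂ) := by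
      rw [intervalIntegral.integral_symm, intervalIntegral.integral_symm L x]
      congr 1
      apply intervalIntegral.integral_congr_ae
      refine Filter.Eventually.of_forall fun t ht => ?_
      rw [uIoc_of_le hx] at ht
      simp [hw, hs t (fun h => absurd h.2 (not_le.2 ht.1))]
    rw [this]; simp
  refine ⟨M, P, hMd, fun k x => ?_, fun k x hx => ⟨?_, hPL k x hx⟩, ?_, ?_⟩
  · rw [← hwM]; exact hPd k x
  · simp only [hM]
    have : ∫ t in x..L, P k t = ∫ t in x..L, (0:ℂ) := by
      apply intervalIntegral.integral_congr
      intro t ht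
      rw [uIcc_of_ge hx] at ht
      exact hPL k t ht.1
    rw [this]; simp
  · have h0 : ∀ k, M k 0 = ((ContinuousMap.evalCLM ℂ (⟨0, le_rfl, hL.le⟩ : Icc (0:ℝ) L))
        (1 - Jop hL.le (q k))) := fun k => hMq k ⟨0, le_rfl, hL.le⟩
    simp_rw [h0]
    have := jsol_diff hL.le v
    fun_prop
  · have h0 : ∀ k, P k 0 = ((ContinuousMap.evalCLM ℂ (⟨0, le_rfl, hL.le⟩ : Icc (0:ℝ) L))
        (q k)) := fun k => hPq k ⟨0, le_rfl, hL.le⟩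
    simp_rw [h0]
    have := jsol_diff hL.le v
    fun_prop


structure IsJost (V : ℝ → ℝ) (L : ℝ) (m p : ℂ → ℝ → ℂ) : Prop where
  contV : Continuous V
  hL : 0 < L
  hs : ∀ x, x ∉ Icc 0 L → V x = 0
  dm : ∀ k x, HasDerivAt (m k) (p k x) x
  dp : ∀ k x, HasDerivAt (p k) (V x * m k x - 2 * Complex.I * k * p k x) x
  hend : ∀ k, ∀ x ≥ L, m k x = 1 ∧ p k x = 0
  am : Differentiable ℂ (fun k => m k 0)
  ap : Differentiable ℂ (fun k => p k 0)

/-- `k a(k)` -/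
noncomputable def jA (m p : ℂ → ℝ → ℂ) (k : ℂ) : ℂ := k * m k 0 + p k 0 / (2 * Complex.I)

namespace IsJost
variable {V : ℝ → ℝ} {L : ℝ} {m p : ℂ → ℝ → ℂ}

lemma diffA (h : IsJost V L m p) : Differentiable ℂ (jA m p) := by
  unfold jA
  have := h.am
  have := h.ap
  fun_prop

lemma two_I_jA (k : ℂ) : 2 * Complex.I * jA m p k = 2 * Complex.I * k * m k 0 + p k 0 := by
  unfold jA
  field_simp

lemma cm (h : IsJost V L m p) (k : ℂ) : Continuous (m k) :=
  continuous_iff_continuousAt.2 fun x => (h.dm k x).continuousAt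

lemma cp (h : IsJost V L m p) (k : ℂ) : Continuous (p k) :=
  continuous_iff_continuousAt.2 fun x => (h.dp k x).continuousAt

lemma wronsk (h : IsJost V L m p) (k : ℂ) (hk : 0 ≤ k.im) :
    k.re ^ 2 * (‖m k 0‖ ^ 2 + Real.exp (-(2 * k.im * L))) ≤
      k.re * (2 * (jA m p k * (starRingEnd ℂ) (m k 0)).re) := by
  set α := k.re with hα
  set κ := k.im with hκ
  have dmr : ∀ x, HasDerivAt (fun x => (m k x).re) (p k x).re x := fun x =>
    Complex.reCLM.hasFDerivAt.comp_hasDerivAt x (h.dm k x)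
  have dmi : ∀ x, HasDerivAt (fun x => (m k x).im) (p k x).im x := fun x =>
    Complex.imCLM.hasFDerivAt.comp_hasDerivAt x (h.dm k x)
  have dpr : ∀ x, HasDerivAt (fun x => (p k x).re)
      (V x * (m k x).re + 2 * κ * (p k x).re + 2 * α * (p k x).im) x := fun x => by
    refine (Complex.reCLM.hasFDerivAt.comp_hasDerivAt x (h.dp k x)).congr_deriv ?_
    simp [← hα, ← hκ]; ring
  have dpi : ∀ x, HasDerivAt (fun x => (p k x).im)
      (V x * (m k x).im + 2 * κ * (p k x).im - 2 * α * (p k x).re) x := fun x => by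
    refine (Complex.imCLM.hasFDerivAt.comp_hasDerivAt x (h.dp k x)).congr_deriv ?_
    simp [← hα, ← hκ]; ring
  set N : ℝ → ℝ := fun x => α * (Real.exp (-(2 * κ * x)) *
    (((p k x).re - α * (m k x).im - κ * (m k x).re) * (-(m k x).im) +
      ((p k x).im + α * (m k x).re - κ * (m k x).im) * (m k x).re)) with hN
  have dN : ∀ x, HasDerivAt N (-(2 * κ * α ^ 2 * Real.exp (-(2 * κ * x)) *
      ((m k x).re ^ 2 + (m k x).im ^ 2))) x := by
    intro x
    have de : HasDerivAt (fun x : ℝ => Real.exp (-(2 * κ * x)))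
        (Real.exp (-(2 * κ * x)) * (-(2 * κ))) x := by
      have := ((hasDerivAt_id x).const_mul (2 * κ)).neg.exp
      simpa using this
    have := (de.mul (((((dpr x).sub ((dmi x).const_mul α)).sub ((dmr x).const_mul κ)).mul (dmi x).neg).add
      ((((dpi x).add ((dmr x).const_mul α)).sub ((dmi x).const_mul κ)).mul (dmr x)))).const_mul α
    refine this.congr_deriv ?_
    simp
    ring
  have hanti : Antitone N := by
    apply antitone_of_deriv_nonpos (fun x => (dN x).differentiableAt)
    intro x
    rw [(dN x).deriv]
    have : 0 ≤ 2 * κ * α ^ 2 * Real.exp (-(2 * κ * x)) * ((m k x).re ^ 2 + (m k x).im ^ 2) := by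
      positivity
    linarith
  have h0 := hanti h.hL.le
  obtain ⟨e1, e2⟩ := h.hend k L le_rfl
  have h2 := two_I_jA (m := m) (p := p) k
  have h2r := congrArg Complex.re h2
  have h2i := congrArg Complex.im h2
  simp [← hα, ← hκ] at h2r h2i
  have hpr : (p k 0).re = -(2 * (jA m p k).im) + 2 * κ * (m k 0).re + 2 * α * (m k 0).im := by
    linarith
  have hpi : (p k 0).im = 2 * (jA m p k).re + 2 * κ * (m k 0).im - 2 * α * (m k 0).re := by
    linarith
  simp only [hN, e1, e2, hpr, hpi] at h0
  simp at h0
  rw [Complex.sq_norm, Complex.normSq_apply]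
  simp only [Complex.mul_re, Complex.conj_re, Complex.conj_im]
  nlinarith [h0]

lemma A_ne_zero_of_re (h : IsJost V L m p) (k : ℂ) (hk : 0 ≤ k.im) (hr : k.re ≠ 0) :
    jA m p k ≠ 0 := by
  intro h0
  have := h.wronsk k hk
  rw [h0] at this
  simp at this
  have h1 : 0 < k.re ^ 2 * (‖m k 0‖ ^ 2 + Real.exp (-(2 * k.im * L))) := by positivity
  linarith

lemma A_real_ge (h : IsJost V L m p) (x : ℝ) : |x| ≤ ‖jA m p x‖ := by
  have h1 := h.wronsk (x : ℂ) (by simp)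
  simp only [Complex.ofReal_re, Complex.ofReal_im] at h1
  simp at h1
  have h2 := Complex.abs_re_le_norm (jA m p x * (starRingEnd ℂ) (m x 0))
  rw [norm_mul, Complex.norm_conj] at h2
  set w := (jA m p x * (starRingEnd ℂ) (m x 0)).re
  have hw : ((jA m p ↑x).re * (m (↑x) 0).re + (jA m p ↑x).im * (m (↑x) 0).im) = w := by
    simp [w]
  rw [hw] at h1
  set u := ‖jA m p x‖
  set v := ‖m x 0‖
  have h3 : x * (2 * w) ≤ 2 * |x| * (u * v) := by
    calc x * (2 * w) ≤ |x * (2 * w)| := le_abs_self _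
      _ = 2 * |x| * |w| := by rw [abs_mul, abs_mul]; simp; ring
      _ ≤ _ := by gcongr
  have h4 : |x| ^ 2 = x ^ 2 := sq_abs x
  have h5 : |x| ^ 2 ≤ u ^ 2 := by nlinarith [sq_nonneg (u - |x| * v)]
  exact (pow_le_pow_iff_left₀ (abs_nonneg _) (norm_nonneg _) two_ne_zero).1 h5

/-- zeros on the imaginary axis are simple -/
lemma simple_zero (h : IsJost V L m p) (z : ℂ) (hz : z.re = 0) (hz' : 0 ≤ z.im) (G : ℂ → ℂ)
    (hG : Continuous G) (hA : ∀ k, jA m p k = (k - z) * G k) : G z ≠ 0 := by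
  intro h0
  have hc : Continuous (fun x : ℝ => z + (x : ℂ)) := by fun_prop
  have hcm : Continuous (fun k => m k 0) := h.am.continuous
  have hin : ∀ x : ℝ, 0 < x → Real.exp (-(2 * z.im * L)) ≤
      2 * (G (z + x) * (starRingEnd ℂ) (m (z + x) 0)).re := by
    intro x hx
    have := h.wronsk (z + x) (by simpa using hz')
    rw [hA] at this
    have e : ((z + x - z) * G (z + x) * (starRingEnd ℂ) (m (z + x) 0)).re =
        x * (G (z + x) * (starRingEnd ℂ) (m (z + x) 0)).re := by
      rw [show (z + x - z) * G (z + x) * (starRingEnd ℂ) (m (z + x) 0) =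
        (x:ℂ) * (G (z + x) * (starRingEnd ℂ) (m (z + x) 0)) by ring, Complex.re_ofReal_mul]
    rw [e] at this
    simp only [Complex.add_re, Complex.add_im, Complex.ofReal_re, Complex.ofReal_im, hz, zero_add,
      add_zero] at this
    set r := (G (z + x) * (starRingEnd ℂ) (m (z + x) 0)).re
    have h1 : 0 ≤ x ^ 2 * ‖m (z + x) 0‖ ^ 2 := by positivity
    have h2 : x ^ 2 * Real.exp (-(2 * z.im * L)) ≤ x ^ 2 * (2 * r) := by nlinarith
    exact le_of_mul_le_mul_left h2 (by positivity)
  have ht : Filter.Tendsto (fun x : ℝ => 2 * (G (z + x) * (starRingEnd ℂ) (m (z + x) 0)).re)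
      (nhdsWithin 0 (Ioi 0)) (nhds (2 * (G (z + (0:ℝ)) * (starRingEnd ℂ) (m (z + (0:ℝ)) 0)).re)) := by
    refine (Continuous.tendsto ?_ 0).mono_left nhdsWithin_le_nhds
    have h1 := hG.comp hc
    have h2 := hcm.comp hc
    have h3 := Complex.continuous_conj.comp h2
    exact continuous_const.mul (Complex.continuous_re.comp (h1.mul h3))
  have := ge_of_tendsto ht (eventually_nhdsWithin_of_forall hin)
  simp [h0] at this
  exact absurd this (not_le.2 (Real.exp_pos _))

end IsJost

lemma ode_zero (c : ℝ → ℂ) (C : ℝ) (hc : ∀ x, ‖c x‖ ≤ C) (g g1 : ℝ → ℂ)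
    (hg : ∀ x, HasDerivAt g (g1 x) x) (hg1 : ∀ x, HasDerivAt g1 (c x * g x) x) (x0 : ℝ)
    (h0 : g x0 = 0) (h1 : g1 x0 = 0) (x : ℝ) : g x = 0 ∧ g1 x = 0 := by
  have hC : 0 ≤ C := (norm_nonneg _).trans (hc 0)
  have := ODE_solution_unique_univ (E := ℂ × ℂ) (v := fun t y => (y.2, c t * y.1)) (s := fun _ => univ)
    (K := ⟨max 1 C, by positivity⟩) (f := fun t => (g t, g1 t)) (g := fun _ => (0,0)) (t₀ := x0) ?_ ?_ ?_ ?_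
  · have := congrFun this x
    simpa using this
  · intro t
    apply LipschitzWith.lipschitzOnWith
    apply LipschitzWith.of_dist_le_mul
    intro y z
    rw [Prod.dist_eq, Prod.dist_eq]
    change _ ≤ max 1 C * _
    have h1 : dist (c t * y.1) (c t * z.1) ≤ C * dist y.1 z.1 := by
      rw [dist_eq_norm, ← mul_sub, norm_mul, ← dist_eq_norm]
      gcongr
      exact hc t
    apply max_le
    · calc dist y.2 z.2 ≤ 1 * max (dist y.1 z.1) (dist y.2 z.2) := by simp
        _ ≤ _ := by gcongr; exact le_max_left _ _
    · refine h1.trans ?_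
      exact mul_le_mul (le_max_right _ _) (le_max_left _ _) dist_nonneg (by positivity)
  · intro t
    exact ⟨(hg t).prodMk (hg1 t), trivial⟩
  · intro t
    refine ⟨?_, trivial⟩
    exact (hasDerivAt_const t ((0:ℂ),(0:ℂ))).congr_deriv (by simp; rfl)
  · simp [h0, h1]


lemma hasDerivAt_tailR {w : ℝ → ℝ} (hw : Continuous w) (L x : ℝ) :
    HasDerivAt (fun y => ∫ t in y..L, w t) (-w x) x :=
  intervalIntegral.integral_hasDerivAt_left (hw.intervalIntegrable _ _)
    (hw.stronglyMeasurableAtFilter _ _) hw.continuousAt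

namespace IsJost
variable {V : ℝ → ℝ} {L : ℝ} {m p : ℂ → ℝ → ℂ}

/-- remainder estimate -/
lemma remainder (hL : 0 < L) (hVc : Continuous V) (ρ : ℝ → ℝ) (hρ : Continuous ρ) :
    ∃ C R : ℝ, 1 ≤ R ∧ 0 ≤ C ∧ ∀ (k z : ℂ) (r q : ℝ → ℂ), -1 ≤ k.im → R ≤ ‖k‖ →
      (∀ x, HasDerivAt r (q x) x) →
      (∀ x, HasDerivAt q (V x * r x - 2 * Complex.I * k * q x - ρ x * z) x) →
      r L = 0 → q L = 0 → ∀ x ∈ Icc 0 L, ‖r x‖ ≤ C * ‖z‖ / ‖k‖ := by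
  obtain ⟨B, hB⟩ := isCompact_Icc.exists_bound_of_continuousOn (s := Icc 0 L) hVc.continuousOn
  obtain ⟨D, hD⟩ := isCompact_Icc.exists_bound_of_continuousOn (s := Icc 0 L) hρ.continuousOn
  have hB0 : 0 ≤ B := (norm_nonneg _).trans (hB 0 ⟨le_rfl, hL.le⟩)
  have hD0 : 0 ≤ D := (norm_nonneg _).trans (hD 0 ⟨le_rfl, hL.le⟩)
  set K := (Real.exp (2 * L) + 1) * L with hK
  have hK0 : 0 < K := by positivity
  refine ⟨K * D, K * B + 1, by nlinarith, by positivity, ?_⟩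
  intro k z r q him hkR hr hq hrL hqL x hx
  have hk0 : 0 < ‖k‖ := by nlinarith
  have hrc : Continuous r := continuous_iff_continuousAt.2 fun x => (hr x).continuousAt
  have hqc : Continuous q := continuous_iff_continuousAt.2 fun x => (hq x).continuousAt
  obtain ⟨x0, hx0, hmax⟩ := isCompact_Icc.exists_isMaxOn (s := Icc 0 L) ⟨x, hx⟩ hrc.norm.continuousOn
  set S := ‖r x0‖ with hS
  have hbd : ∀ t ∈ Icc 0 L, ‖(V t : ℂ) * r t - ρ t * z‖ ≤ B * S + D * ‖z‖ := by
    intro t ht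
    refine (norm_sub_le _ _).trans ?_
    rw [norm_mul, norm_mul, Complex.norm_real, Complex.norm_real]
    have := hmax ht
    gcongr
    · exact hB t ht
    · exact this
    · exact hD t ht
  have hgc : Continuous (fun t : ℝ => (V t : ℂ) * r t - ρ t * z) := by fun_prop
  have hBS : 0 ≤ B * S + D * ‖z‖ := by positivity
  -- first identity
  have i1 : ∫ t in x0..L, ((V t : ℂ) * r t - ρ t * z) =
      (2 * Complex.I * k * r L + q L) - (2 * Complex.I * k * r x0 + q x0) := by
    apply intervalIntegral.integral_eq_sub_of_hasDerivAt
      (f := fun t => 2 * Complex.I * k * r t + q t)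
    · intro t _
      refine (((hr t).const_mul (2 * Complex.I * k)).add (hq t)).congr_deriv ?_
      ring
    · exact hgc.intervalIntegrable _ _
  have i2 : ∫ t in x0..L, Complex.exp (2 * Complex.I * k * (t - x0)) * ((V t : ℂ) * r t - ρ t * z) =
      Complex.exp (2 * Complex.I * k * (L - x0)) * q L -
        Complex.exp (2 * Complex.I * k * (x0 - x0)) * q x0 := by
    apply intervalIntegral.integral_eq_sub_of_hasDerivAt
      (f := fun t : ℝ => Complex.exp (2 * Complex.I * k * (t - x0)) * q t)
    · intro t _
      have h2 : HasDerivAt (fun x : ℝ => Complex.exp ((2 * Complex.I * k * (x - x0))))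
            (Complex.exp ((2 * Complex.I * k * (t - x0))) * ((2 * Complex.I * k))) t := by
        have := (((Complex.ofRealCLM.hasDerivAt (x := t)).sub_const (x0:ℂ)).const_mul (2 * Complex.I * k)).cexp
        simpa using this
      refine (h2.mul (hq t)).congr_deriv ?_
      ring
    · exact Continuous.intervalIntegrable (by fun_prop) _ _
  have n1 : ‖∫ t in x0..L, ((V t : ℂ) * r t - ρ t * z)‖ ≤ (B * S + D * ‖z‖) * L := by
    refine (intervalIntegral.norm_integral_le_of_norm_le_const (C := B * S + D * ‖z‖) ?_).trans ?_
    · intro t ht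
      rw [uIoc_of_le hx0.2] at ht
      exact hbd t ⟨hx0.1.trans ht.1.le, ht.2⟩
    · rw [abs_of_nonneg (sub_nonneg.2 hx0.2)]
      gcongr
      linarith [hx0.1]
  have n2 : ‖∫ t in x0..L, Complex.exp (2 * Complex.I * k * (t - x0)) * ((V t : ℂ) * r t - ρ t * z)‖
      ≤ (Real.exp (2 * L) * (B * S + D * ‖z‖)) * L := by
    refine (intervalIntegral.norm_integral_le_of_norm_le_const
      (C := Real.exp (2 * L) * (B * S + D * ‖z‖)) ?_).trans ?_
    · intro t ht
      rw [uIoc_of_le hx0.2] at ht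
      rw [norm_mul, Complex.norm_exp]
      have ht' := hbd t ⟨hx0.1.trans ht.1.le, ht.2⟩
      gcongr
      simp
      have h1 : 0 ≤ t - x0 := by linarith [ht.1]
      have h2 : t - x0 ≤ L := by linarith [ht.2, hx0.1]
      nlinarith
    · rw [abs_of_nonneg (sub_nonneg.2 hx0.2)]
      gcongr
      linarith [hx0.1]
  rw [hrL, hqL] at i1
  rw [hqL] at i2
  simp at i1 i2
  have hq0 : ‖q x0‖ ≤ (Real.exp (2 * L) * (B * S + D * ‖z‖)) * L := by
    rw [i2, norm_neg] at n2; exact n2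
  have h3 : ‖2 * Complex.I * k * r x0‖ ≤ K * (B * S + D * ‖z‖) := by
    have : 2 * Complex.I * k * r x0 = -(∫ t in x0..L, ((V t : ℂ) * r t - ρ t * z)) - q x0 := by
      rw [i1]; ring
    rw [this]
    refine (norm_sub_le _ _).trans ?_
    rw [norm_neg]
    calc _ ≤ (B * S + D * ‖z‖) * L + (Real.exp (2 * L) * (B * S + D * ‖z‖)) * L := add_le_add n1 hq0
      _ = _ := by rw [hK]; ring
  have h4 : ‖2 * Complex.I * k * r x0‖ = 2 * ‖k‖ * S := by simp [hS]
  rw [h4] at h3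
  have hS0 : 0 ≤ S := norm_nonneg _
  have h5 : ‖k‖ * S ≤ K * D * ‖z‖ := by nlinarith
  have h6 : S ≤ K * D * ‖z‖ / ‖k‖ := by
    rw [le_div_iff₀ hk0]; linarith
  exact (hmax hx).trans h6

lemma mono (h : IsJost V L m p) {L' : ℝ} (hLL : L ≤ L') : IsJost V L' m p :=
  { contV := h.contV
    hL := h.hL.trans_le hLL
    hs := fun x hx => h.hs x (fun hx' => hx ⟨hx'.1, hx'.2.trans hLL⟩)
    dm := h.dm
    dp := h.dp
    hend := fun k x hx => h.hend k x (hLL.trans hx)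
    am := h.am
    ap := h.ap }

lemma A_integral (h : IsJost V L m p) (k : ℂ) :
    2 * Complex.I * jA m p k = 2 * Complex.I * k - ∫ t in (0:ℝ)..L, V t * m k t := by
  have i1 : ∫ t in (0:ℝ)..L, (V t : ℂ) * m k t =
      (2 * Complex.I * k * m k L + p k L) - (2 * Complex.I * k * m k 0 + p k 0) := by
    apply intervalIntegral.integral_eq_sub_of_hasDerivAt
      (f := fun t => 2 * Complex.I * k * m k t + p k t)
    · intro t _
      refine (((h.dm k t).const_mul (2 * Complex.I * k)).add (h.dp k t)).congr_deriv ?_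
      ring
    · have := h.cm k
      have := h.contV
      exact Continuous.intervalIntegrable (by fun_prop) _ _
  obtain ⟨e1, e2⟩ := h.hend k L le_rfl
  rw [two_I_jA, i1, e1, e2]; ring

lemma V_zero (h : IsJost V L m p) : V 0 = 0 := by
  have hcl : IsClosed {x | V x = 0} := isClosed_eq h.contV continuous_const
  have hsub : Iio (0:ℝ) ⊆ {x | V x = 0} := fun x hx => h.hs x (fun hx' => absurd hx'.1 (not_le.2 hx))
  have := hcl.closure_subset_iff.2 hsub
  rw [closure_Iio] at this
  exact this (by simp : (0:ℝ) ∈ Iic 0)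

lemma asym1 (h0 : IsJost V L m p) (hV : ContDiff ℝ (⊤ : ℕ∞) V) (Q P : ℝ)
    (hQ : Q = ∫ x in (0:ℝ)..(L+1), V x) (hP : P = ∫ x in (0:ℝ)..(L+1), V x ^ 2) :
    ∃ C R : ℝ, 1 ≤ R ∧ 0 ≤ C ∧ ∀ k z : ℂ, -1 ≤ k.im → R ≤ ‖k‖ → 2 * Complex.I * k * z = 1 →
      ‖jA m p k / k - (1 - Q * z + Q ^ 2 / 2 * z ^ 2 + (P - Q ^ 3 / 6) * z ^ 3 +
        (Q ^ 4 / 24 - Q * P) * z ^ 4)‖ ≤ C * ‖z‖ ^ 5 := by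
  have h : IsJost V (L+1) m p := h0.mono (by linarith)
  set L1 := L + 1 with hL1
  have hc1 : ContDiff ℝ (⊤ : ℕ∞) (deriv V) := (contDiff_infty_iff_deriv.1 hV).2
  have hc2 : ContDiff ℝ (⊤ : ℕ∞) (deriv (deriv V)) := (contDiff_infty_iff_deriv.1 hc1).2
  have hc3 : ContDiff ℝ (⊤ : ℕ∞) (deriv (deriv (deriv V))) := (contDiff_infty_iff_deriv.1 hc2).2
  set V1 := deriv V with hV1
  set V2 := deriv V1 with hV2
  set V3 := deriv V2 with hV3
  have d0 : ∀ x, HasDerivAt V (V1 x) x := fun x => (contDiff_infty_iff_deriv.1 hV).1.differentiableAt.hasDerivAt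
  have d1 : ∀ x, HasDerivAt V1 (V2 x) x := fun x => (contDiff_infty_iff_deriv.1 hc1).1.differentiableAt.hasDerivAt
  have d2 : ∀ x, HasDerivAt V2 (V3 x) x := fun x => (contDiff_infty_iff_deriv.1 hc2).1.differentiableAt.hasDerivAt
  have cV := h.contV
  have cV1 := hc1.continuous
  have cV2 := hc2.continuous
  have cV3 := hc3.continuous
  have ev0 : V =ᶠ[nhds L1] fun _ => 0 := by
    filter_upwards [lt_mem_nhds (show L < L1 by linarith)] with x hx
    exact h0.hs x (fun hx' => absurd hx'.2 (not_le.2 hx))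
  have ev1 : V1 =ᶠ[nhds L1] fun _ => 0 := by simpa using ev0.deriv
  have ev2 : V2 =ᶠ[nhds L1] fun _ => 0 := by simpa using ev1.deriv
  have z0 : V L1 = 0 := ev0.eq_of_nhds
  have z1 : V1 L1 = 0 := ev1.eq_of_nhds
  have z2 : V2 L1 = 0 := ev2.eq_of_nhds
  set U : ℝ → ℝ := fun x => -∫ t in x..L1, V t with hU
  set W : ℝ → ℝ := fun x => ∫ t in x..L1, V t ^ 2 with hW
  have dU : ∀ x, HasDerivAt U (V x) x := fun x =>
    (hasDerivAt_tailR cV L1 x).neg.congr_deriv (neg_neg _)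
  have dW : ∀ x, HasDerivAt W (-(V x ^ 2)) x := fun x => hasDerivAt_tailR (cV.pow 2) L1 x
  have cU : Continuous U := continuous_iff_continuousAt.2 fun x => (dU x).continuousAt
  have cW : Continuous W := continuous_iff_continuousAt.2 fun x => (dW x).continuousAt
  have UL : U L1 = 0 := by simp [hU]
  have WL : W L1 = 0 := by simp [hW]
  have U0 : U 0 = -Q := by simp [hU, hQ]
  have W0 : W 0 = P := by simp [hW, hP]
  set ρ : ℝ → ℝ := fun x => U x * V x ^ 2 + U x ^ 2 * V1 x / 2 - V2 x * U x - V1 x * V x -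
    4 * V x * V1 x + V3 x - V x * (U x ^ 3 / 6 - V x * U x + V1 x + W x) with hρ
  have cρ : Continuous ρ := by fun_prop
  obtain ⟨C, R, hR, hC, key⟩ := remainder h.hL cV ρ cρ
  obtain ⟨B, hB⟩ := isCompact_Icc.exists_bound_of_continuousOn (s := Icc 0 L1) cV.continuousOn
  have hB0 : 0 ≤ B := (norm_nonneg _).trans (hB 0 ⟨le_rfl, h.hL.le⟩)
  refine ⟨B * (2 * C) * L1, R, hR, by have := h.hL; positivity, ?_⟩
  intro k z him hkR hkz
  have hk0 : 0 < ‖k‖ := by linarith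
  have hkne : k ≠ 0 := norm_pos_iff.1 hk0
  set mN : ℝ → ℂ := fun x => 1 + (U x : ℂ) * z + ((U x) ^ 2 / 2 - V x) * z ^ 2 +
    ((U x) ^ 3 / 6 - V x * U x + V1 x + W x) * z ^ 3 with hmN
  set pN : ℝ → ℂ := fun x => (V x : ℂ) * z + (V x * U x - V1 x) * z ^ 2 +
    ((U x) ^ 2 * V x / 2 - V1 x * U x - 2 * V x ^ 2 + V2 x) * z ^ 3 with hpN
  have oU := fun x => (dU x).ofReal_comp
  have oW := fun x => (dW x).ofReal_comp
  have o0 := fun x => (d0 x).ofReal_comp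
  have o1 := fun x => (d1 x).ofReal_comp
  have o2 := fun x => (d2 x).ofReal_comp
  have dmN : ∀ x, HasDerivAt mN (pN x) x := by
    intro x
    have := ((((oU x).mul_const z).const_add 1).add
      (((((oU x).pow 2).div_const 2).sub (o0 x)).mul_const (z^2))).add
      (((((((oU x).pow 3).div_const 6).sub ((o0 x).mul (oU x))).add (o1 x)).add (oW x)).mul_const (z^3))
    refine this.congr_deriv ?_
    simp only [hpN]
    push_cast
    simp
    ring
  have dpN : ∀ x, HasDerivAt pN (V x * mN x - 2 * Complex.I * k * pN x + ρ x * z ^ 3) x := by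
    intro x
    have := (((o0 x).mul_const z).add ((((o0 x).mul (oU x)).sub (o1 x)).mul_const (z^2))).add
      ((((((((oU x).pow 2).mul (o0 x)).div_const 2).sub ((o1 x).mul (oU x))).sub
        (((o0 x).pow 2).const_mul 2)).add (o2 x)).mul_const (z^3))
    refine this.congr_deriv ?_
    simp only [hpN, hmN, hρ]
    push_cast
    simp
    linear_combination ((V x : ℂ) + (V x * U x - V1 x) * z +
      ((U x) ^ 2 * V x / 2 - V1 x * U x - 2 * V x ^ 2 + V2 x) * z ^ 2) * hkz
  obtain ⟨e1, e2⟩ := h.hend k L1 le_rfl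
  have hr := key k (z^3) (fun x => m k x - mN x) (fun x => p k x - pN x) him hkR
    (fun x => (h.dm k x).sub (dmN x))
    (fun x => ((h.dp k x).sub (dpN x)).congr_deriv (by ring))
    (by simp [e1, hmN, UL, WL, z0, z1])
    (by simp [e2, hpN, UL, z0, z1, z2])
  have cmN : Continuous mN := continuous_iff_continuousAt.2 fun x => (dmN x).continuousAt
  have cm := h.cm k
  have hA := h.A_integral k
  have hintg : ∫ t in (0:ℝ)..L1, (V t : ℂ) * m k t =
      (∫ t in (0:ℝ)..L1, (V t : ℂ) * mN t) + ∫ t in (0:ℝ)..L1, (V t : ℂ) * (m k t - mN t) := by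
    rw [← intervalIntegral.integral_add]
    · congr 1; ext t; ring
    · exact Continuous.intervalIntegrable (by fun_prop) _ _
    · exact Continuous.intervalIntegrable (by fun_prop) _ _
  have hmain : ∫ t in (0:ℝ)..L1, (V t : ℂ) * mN t =
      Q - Q ^ 2 / 2 * z - (P - Q ^ 3 / 6) * z ^ 2 - (Q ^ 4 / 24 - Q * P) * z ^ 3 := by
    have := intervalIntegral.integral_eq_sub_of_hasDerivAt (a := 0) (b := L1)
      (f := fun x : ℝ => (U x : ℂ) + (U x : ℂ) ^ 2 / 2 * z + ((U x : ℂ) ^ 3 / 6 + W x) * z ^ 2 +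
        ((U x : ℂ) ^ 4 / 24 + W x * U x + V x ^ 2 / 2) * z ^ 3)
      (f' := fun t => (V t : ℂ) * mN t) ?_ (Continuous.intervalIntegrable (by fun_prop) _ _)
    · rw [this, UL, WL, z0, U0, W0, h.V_zero]
      push_cast
      ring
    · intro x _
      have := (((oU x).add ((((oU x).pow 2).div_const 2).mul_const z)).add
        (((((oU x).pow 3).div_const 6).add (oW x)).mul_const (z^2))).add
        ((((((oU x).pow 4).div_const 24).add ((oW x).mul (oU x))).add
          (((o0 x).pow 2).div_const 2)).mul_const (z^3))
      refine this.congr_deriv ?_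
      simp only [hmN]
      push_cast
      simp
      ring
  have herr : ‖∫ t in (0:ℝ)..L1, (V t : ℂ) * (m k t - mN t)‖ ≤ (B * (2 * C) * L1) * ‖z‖ ^ 4 := by
    have hkz' : 2 * ‖k‖ * ‖z‖ = 1 := by
      have := congrArg norm hkz
      simpa using this
    have hki : 1 / ‖k‖ = 2 * ‖z‖ := by field_simp; linarith
    refine (intervalIntegral.norm_integral_le_of_norm_le_const
      (C := B * (C * ‖z^3‖ / ‖k‖)) ?_).trans ?_
    · intro t ht
      rw [uIoc_of_le h.hL.le] at ht
      have ht' : t ∈ Icc 0 L1 := ⟨ht.1.le, ht.2⟩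
      rw [norm_mul, Complex.norm_real]
      gcongr
      · exact hB t ht'
      · exact hr t ht'
    · rw [sub_zero, abs_of_pos h.hL, div_eq_mul_one_div, hki, norm_pow]
      exact le_of_eq (by ring)
  have hfin : jA m p k / k - (1 - Q * z + Q ^ 2 / 2 * z ^ 2 + (P - Q ^ 3 / 6) * z ^ 3 +
        (Q ^ 4 / 24 - Q * P) * z ^ 4) = - z * ∫ t in (0:ℝ)..L1, (V t : ℂ) * (m k t - mN t) := by
    rw [hintg, hmain] at hA
    have hzk : jA m p k / k = 2 * Complex.I * jA m p k * z := by
      field_simp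
      linear_combination (- jA m p k) * hkz
    rw [hzk, hA]
    linear_combination hkz
  rw [hfin, norm_mul, norm_neg]
  calc _ ≤ ‖z‖ * ((B * (2 * C) * L1) * ‖z‖ ^ 4) := by gcongr
    _ = _ := by ring

noncomputable def remPoly (Q P z : ℂ) : ℂ :=
  (-1/2)*z^0*Q^2*P^1 + (-1/2)*z^1*Q^0*P^2 + (-1/3)*z^1*Q^3*P^1 + (1/72)*z^1*Q^6*P^0 +
    (-1/12)*z^2*Q^4*P^1 + (1/2)*z^3*Q^2*P^2 + (-1/12)*z^3*Q^5*P^1 + (1/576)*z^3*Q^8*P^0 + (1/3)*z^4*Q^0*P^3 +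
    (1/4)*z^4*Q^3*P^2 + (1/144)*z^4*Q^6*P^1 + (11/48)*z^5*Q^4*P^2 + (-1/144)*z^5*Q^7*P^1 + (-1/6)*z^6*Q^2*P^3 +
    (-1/48)*z^6*Q^5*P^2 + (-1/8)*z^7*Q^0*P^4 + (-11/36)*z^7*Q^3*P^3 + (1/96)*z^7*Q^6*P^2 + (-1/24)*z^8*Q^1*P^4 + (1/48)*z^8*Q^4*P^3 +
    (3/16)*z^9*Q^2*P^4 + (-1/144)*z^9*Q^5*P^3 + (1/24)*z^10*Q^0*P^5 + (-1/144)*z^10*Q^3*P^4 + (-1/24)*z^11*Q^1*P^5 + (1/576)*z^11*Q^4*P^4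

lemma asym2 (h : IsJost V L m p) (hV : ContDiff ℝ (⊤ : ℕ∞) V) (Q P : ℝ)
    (hQ : Q = ∫ x in (0:ℝ)..(L+1), V x) (hP : P = ∫ x in (0:ℝ)..(L+1), V x ^ 2) :
    ∃ C R : ℝ, 1 ≤ R ∧ 0 ≤ C ∧ ∀ k z : ℂ, -1 ≤ k.im → R ≤ ‖k‖ → 2 * Complex.I * k * z = 1 →
      ‖jA m p k / k * Complex.exp (Q * z - P * z ^ 3) - 1‖ ≤ C * ‖z‖ ^ 5 := by
  obtain ⟨C, R, hR, hC, key⟩ := h.asym1 hV Q P hQ hP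
  have comp := isCompact_closedBall (0:ℂ) 1
  have hin0 : (0:ℂ) ∈ Metric.closedBall (0:ℂ) 1 := by simp
  obtain ⟨C1, hC1⟩ := comp.exists_bound_of_continuousOn
    (f := fun z : ℂ => Complex.exp (Q * z - P * z ^ 3)) (by fun_prop)
  obtain ⟨C2, hC2⟩ := comp.exists_bound_of_continuousOn
    (f := fun z : ℂ => (1 - Q * z + Q ^ 2 / 2 * z ^ 2 + (P - Q ^ 3 / 6) * z ^ 3 +
        (Q ^ 4 / 24 - Q * P) * z ^ 4)) (by fun_prop)
  obtain ⟨C3, hC3⟩ := comp.exists_bound_of_continuousOn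
    (f := fun z : ℂ => remPoly Q P z) (by unfold remPoly; fun_prop)
  obtain ⟨C4, hC4⟩ := comp.exists_bound_of_continuousOn
    (f := fun z : ℂ => ((Q:ℂ) - P * z ^ 2)) (by fun_prop)
  have p1 : 0 ≤ C1 := (norm_nonneg _).trans (hC1 0 hin0)
  have p2 : 0 ≤ C2 := (norm_nonneg _).trans (hC2 0 hin0)
  have p3 : 0 ≤ C3 := (norm_nonneg _).trans (hC3 0 hin0)
  have p4 : 0 ≤ C4 := (norm_nonneg _).trans (hC4 0 hin0)
  refine ⟨C * C1 + C2 * (C4 ^ 5 * Real.exp C4) + C3, R, hR, by positivity, ?_⟩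
  intro k z him hkR hkz
  have hkz' : 2 * ‖k‖ * ‖z‖ = 1 := by
    have := congrArg norm hkz
    simpa using this
  have hz1 : ‖z‖ ≤ 1 := by nlinarith [norm_nonneg z]
  have hzm : z ∈ Metric.closedBall (0:ℂ) 1 := by simpa using hz1
  have b0 := key k z him hkR hkz
  have b1 := hC1 z hzm
  have b2 := hC2 z hzm
  have b3 := hC3 z hzm
  have b4 := hC4 z hzm
  set po := (1 - Q * z + Q ^ 2 / 2 * z ^ 2 + (P - Q ^ 3 / 6) * z ^ 3 +
        (Q ^ 4 / 24 - Q * P) * z ^ 4) with hpo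
  set y := Q * z - P * z ^ 3 with hy
  have hyn : ‖y‖ ≤ C4 * ‖z‖ := by
    rw [hy, show Q * z - P * z ^ 3 = (Q - P * z ^ 2) * z by ring, norm_mul]
    gcongr
  have hyn' : ‖y‖ ≤ C4 := hyn.trans (by nlinarith)
  have b5 := Complex.norm_exp_sub_sum_le_norm_mul_exp y 5
  have b5' : ‖Complex.exp y - ∑ j ∈ Finset.range 5, y ^ j / (j.factorial : ℂ)‖ ≤
      (C4 ^ 5 * Real.exp C4) * ‖z‖ ^ 5 := by
    refine b5.trans ?_
    calc _ ≤ (C4 * ‖z‖) ^ 5 * Real.exp C4 := by gcongr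
      _ = _ := by ring
  set T := ∑ j ∈ Finset.range 5, y ^ j / (j.factorial : ℂ) with hT
  have e : jA m p k / k * Complex.exp y - 1 = (jA m p k / k - po) * Complex.exp y +
      po * (Complex.exp y - T) + (po * T - 1) := by ring
  have e2 : po * T - 1 = remPoly Q P z * z ^ 5 := by
    rw [hT, hpo]
    simp only [Finset.sum_range_succ, Finset.sum_range_zero, Nat.factorial]
    rw [hy]
    unfold remPoly
    push_cast
    ring
  rw [e]
  refine (norm_add₃_le).trans ?_
  rw [norm_mul, norm_mul, e2, norm_mul, norm_pow]
  calc _ ≤ (C * ‖z‖ ^ 5) * C1 + C2 * ((C4 ^ 5 * Real.exp C4) * ‖z‖ ^ 5) + C3 * ‖z‖ ^ 5 := by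
        gcongr
    _ = _ := by ring

end IsJost


lemma factor_finset (A : ℂ → ℂ) (hA : Differentiable ℂ A) (Z : Finset ℂ)
    (hZ : ∀ z ∈ Z, A z = 0) :
    ∃ G : ℂ → ℂ, Differentiable ℂ G ∧ ∀ k, A k = (∏ z ∈ Z, (k - z)) * G k := by
  classical
  induction Z using Finset.induction_on with
  | empty => exact ⟨A, hA, by simp⟩
  | insert w Z hw ih =>
    obtain ⟨G, hG, hk⟩ := ih (fun z hz => hZ z (Finset.mem_insert_of_mem hz))
    have hw0 : G w = 0 := by
      have h0 := hZ w (Finset.mem_insert_self _ _)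
      rw [hk w] at h0
      rcases mul_eq_zero.1 h0 with h1 | h1
      · obtain ⟨z, hz, hzz⟩ := Finset.prod_eq_zero_iff.1 h1
        rw [sub_eq_zero] at hzz
        exact absurd (hzz ▸ hz) hw
      · exact h1
    refine ⟨dslope G w, ?_, ?_⟩
    · have := (Complex.differentiableOn_dslope (f := G) (c := w) (s := univ) Filter.univ_mem).2
        hG.differentiableOn
      exact differentiableOn_univ.1 this
    · intro k
      rw [Finset.prod_insert hw, hk k]
      have := sub_smul_dslope G w k
      rw [hw0, sub_zero, smul_eq_mul] at this
      rw [← this]; ring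

namespace IsJost
variable {V : ℝ → ℝ} {L : ℝ} {m p : ℂ → ℝ → ℂ}

lemma A_large (h : IsJost V L m p) (hV : ContDiff ℝ (⊤ : ℕ∞) V) :
    ∃ R : ℝ, ∀ k : ℂ, -1 ≤ k.im → R ≤ ‖k‖ → jA m p k ≠ 0 := by
  obtain ⟨C, R, hR, hC, key⟩ := h.asym2 hV _ _ rfl rfl
  refine ⟨max R (C + 1), fun k hk hkR h0 => ?_⟩
  have h1 : R ≤ ‖k‖ := (le_max_left _ _).trans hkR
  have h2 : C + 1 ≤ ‖k‖ := (le_max_right _ _).trans hkR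
  have hk0 : k ≠ 0 := by
    rintro rfl; simp at h1; linarith
  have hz : 2 * Complex.I * k * (1 / (2 * Complex.I * k)) = 1 := by
    field_simp
  have := key k _ hk h1 hz
  rw [h0] at this
  simp only [zero_div, zero_mul, zero_sub, norm_neg, norm_one] at this
  set z := 1 / (2 * Complex.I * k) with hzz
  have hn : 2 * ‖k‖ * ‖z‖ = 1 := by
    have := congrArg norm hz
    simpa using this
  have hz0 := norm_nonneg z
  have hz1 : ‖z‖ ≤ 1 := by nlinarith
  have : C * ‖z‖ ^ 5 ≤ C * ‖z‖ := by
    refine mul_le_mul_of_nonneg_left ?_ hC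
    calc ‖z‖ ^ 5 ≤ ‖z‖ ^ 1 := pow_le_pow_of_le_one hz0 hz1 (by norm_num)
      _ = _ := pow_one _
  nlinarith

lemma zeros_finite (h : IsJost V L m p) (hV : ContDiff ℝ (⊤ : ℕ∞) V) :
    {z : ℂ | 0 ≤ z.im ∧ jA m p z = 0}.Finite := by
  obtain ⟨R, hR⟩ := h.A_large hV
  by_contra hinf
  have hsub : {z : ℂ | 0 ≤ z.im ∧ jA m p z = 0} ⊆ Metric.closedBall 0 R := by
    rintro z ⟨h1, h2⟩
    by_contra hz
    simp only [Metric.mem_closedBall, dist_zero_right, not_le] at hz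
    exact hR z (by linarith) hz.le h2
  obtain ⟨x, hx, hacc⟩ := Set.Infinite.exists_accPt_of_subset_isCompact hinf
    (isCompact_closedBall (0:ℂ) R) hsub
  have han : AnalyticOnNhd ℂ (jA m p) univ := h.diffA.differentiableOn.analyticOnNhd isOpen_univ
  have hfr : ∃ᶠ z in nhdsWithin x {x}ᶜ, jA m p z = (fun _ => (0:ℂ)) z := by
    rw [accPt_iff_frequently_nhdsNE] at hacc
    exact hacc.mono fun z hz => hz.2
  have := han.eq_of_frequently_eq (analyticOnNhd_const) hfr
  have h1 := h.A_real_ge 1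
  rw [this] at h1
  simp at h1
  linarith

lemma factor (h : IsJost V L m p) (hV : ContDiff ℝ (⊤ : ℕ∞) V) :
    ∃ (Z : Finset ℂ) (G : ℂ → ℂ), Differentiable ℂ G ∧
      (∀ z, z ∈ Z ↔ 0 ≤ z.im ∧ jA m p z = 0) ∧
      (∀ k, jA m p k = (∏ z ∈ Z, (k - z)) * G k) ∧ ∀ k : ℂ, 0 ≤ k.im → G k ≠ 0 := by
  classical
  have hfin := h.zeros_finite hV
  obtain ⟨G, hG, hk⟩ := factor_finset (jA m p) h.diffA hfin.toFinset
    (fun z hz => ((hfin.mem_toFinset).1 hz).2)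
  refine ⟨hfin.toFinset, G, hG, fun z => hfin.mem_toFinset, hk, ?_⟩
  intro k hkim hGk
  have hA0 : jA m p k = 0 := by rw [hk k, hGk, mul_zero]
  have hmem : k ∈ hfin.toFinset := hfin.mem_toFinset.2 ⟨hkim, hA0⟩
  have hre : k.re = 0 := by
    by_contra hne
    exact h.A_ne_zero_of_re k hkim hne hA0
  refine h.simple_zero k hre hkim (fun w => (∏ z ∈ hfin.toFinset.erase k, (w - z)) * G w) ?_ ?_ ?_
  · exact (continuous_finsetProd _ fun z _ => by fun_prop).mul hG.continuous
  · intro w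
    rw [hk w, ← Finset.mul_prod_erase _ _ hmem, mul_assoc]
  · simp [hGk]

end IsJost


namespace IsJost
variable {V : ℝ → ℝ} {L : ℝ} {m p : ℂ → ℝ → ℂ}

lemma logA_asym (h : IsJost V L m p) (hV : ContDiff ℝ (⊤ : ℕ∞) V) (Q P : ℝ)
    (hQ : Q = ∫ x in (0:ℝ)..(L+1), V x) (hP : P = ∫ x in (0:ℝ)..(L+1), V x ^ 2) :
    ∃ C R : ℝ, 1 ≤ R ∧ ∀ k : ℂ, 0 ≤ k.im → R ≤ ‖k‖ →
      ‖k ^ 3 * logDeriv (jA m p) k - k ^ 2 + Complex.I * Q * k / 2 + 3 * Complex.I * P / 8 / k‖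
        ≤ C / ‖k‖ ^ 2 := by
  obtain ⟨C, R, hR, hC, key⟩ := h.asym2 hV Q P hQ hP
  refine ⟨4 * C, 2 * R + 2 * C + 2, by linarith, fun k hk hkR => ?_⟩
  set e : ℂ → ℂ := fun w => jA m p w / w *
    Complex.exp (Q * (1 / (2 * Complex.I * w)) - P * (1 / (2 * Complex.I * w)) ^ 3) - 1 with he
  have hkpos : 0 < ‖k‖ := by linarith
  have hk0 : k ≠ 0 := norm_pos_iff.1 hkpos
  have hw : ∀ w ∈ Metric.closedBall k (1/2), -1 ≤ w.im ∧ R ≤ ‖w‖ ∧ ‖k‖ ≤ 2 * ‖w‖ := by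
    intro w hw
    rw [Metric.mem_closedBall, dist_eq_norm] at hw
    have h1 := (Complex.abs_im_le_norm (w - k)).trans hw
    rw [Complex.sub_im, abs_le] at h1
    have h2 := norm_sub_norm_le k w
    rw [norm_sub_rev] at h2
    refine ⟨by linarith, by linarith, by linarith⟩
  have hw0 : ∀ w ∈ Metric.closedBall k (1/2), w ≠ 0 := by
    intro w hw'
    have := (hw w hw').2.1
    rw [← norm_pos_iff]; linarith
  have hbd : ∀ w ∈ Metric.closedBall k (1/2), ‖e w‖ ≤ C / ‖k‖ ^ 5 := by
    intro w hw'
    obtain ⟨h1, h2, h3⟩ := hw w hw'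
    have hw0 := hw0 w hw'
    have := key w (1 / (2 * Complex.I * w)) h1 h2 (by field_simp)
    refine this.trans ?_
    rw [div_eq_mul_one_div C]
    refine mul_le_mul_of_nonneg_left ?_ hC
    rw [norm_div, norm_mul, norm_mul]
    simp only [norm_one, Complex.norm_ofNat, Complex.norm_I, mul_one]
    rw [← one_div_pow]
    gcongr
  have hdA : ∀ w ∈ Metric.closedBall k (1/2), DifferentiableAt ℂ e w := by
    intro w hw'
    have hw0 := hw0 w hw'
    have := h.diffA w
    have h2 : (2 * Complex.I * w) ≠ 0 := by simp [hw0]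
    simp only [he]
    fun_prop (disch := assumption)
  have hder : ‖deriv e k‖ ≤ (C / ‖k‖ ^ 5) / (1/2) := by
    apply Complex.norm_deriv_le_of_forall_mem_sphere_norm_le (by norm_num)
    · apply DifferentiableOn.diffContOnCl
      intro w hw'
      rw [closure_ball _ (by norm_num)] at hw'
      exact (hdA w hw').differentiableWithinAt
    · intro w hw'
      exact hbd w (Metric.sphere_subset_closedBall hw')
  have hkk : k ∈ Metric.closedBall k (1/2) := Metric.mem_closedBall_self (by norm_num)
  have hek := hbd k hkk
  have hk1 : 1 ≤ ‖k‖ := by linarith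
  have hehalf : ‖e k‖ ≤ 1 / 2 := by
    refine hek.trans ?_
    rw [div_le_iff₀ (by positivity)]
    have : ‖k‖ ≤ ‖k‖ ^ 5 := le_self_pow₀ hk1 (by norm_num)
    nlinarith
  have h1e : 1 / 2 ≤ ‖1 + e k‖ := by
    have := norm_sub_norm_le (1:ℂ) (-(e k))
    rw [norm_neg, norm_one, sub_neg_eq_add] at this
    linarith
  have h1e0 : 1 + e k ≠ 0 := by rw [← norm_pos_iff]; linarith
  have hAk : jA m p k ≠ 0 := by
    intro h0; apply h1e0; simp [he, h0]
  -- derivative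
  set φ : ℂ := Q * (1 / (2 * Complex.I * k)) - P * (1 / (2 * Complex.I * k)) ^ 3 with hφ
  have h2k : 2 * Complex.I * k ≠ 0 := by simp [hk0]
  have d0 : HasDerivAt (fun w : ℂ => 1 / (2 * Complex.I * w)) (Complex.I / (2 * k ^ 2)) k := by
    have : HasDerivAt (fun w : ℂ => 2 * Complex.I * w) (2 * Complex.I) k := by
      simpa using (hasDerivAt_id k).const_mul (2 * Complex.I)
    have := (hasDerivAt_const k (1:ℂ)).div this h2k
    refine this.congr_deriv ?_
    field_simp
    linear_combination (-1 : ℂ) * Complex.I_sq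
  have dφ := (d0.const_mul (Q:ℂ)).sub ((d0.pow 3).const_mul (P:ℂ))
  have de := ((((h.diffA k).hasDerivAt.div (hasDerivAt_id k) hk0)).mul dφ.cexp).sub_const 1
  have de' : deriv e k = (1 + e k) * (logDeriv (jA m p) k - 1 / k + Complex.I * Q / (2 * k ^ 2)
      + 3 * Complex.I * P / (8 * k ^ 4)) := by
    have : deriv e k = _ := de.deriv
    rw [this]
    simp only [he, logDeriv_apply, id]
    have hE : ((3:ℕ):ℂ) * (1 / (2 * Complex.I * k)) ^ (3 - 1) * (Complex.I / (2 * k ^ 2)) =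
        - (3 * Complex.I / (8 * k ^ 4)) := by
      simp only [one_div, mul_inv, mul_pow, Complex.inv_I]
      norm_num
      field_simp
      norm_num
    simp only [hE, Pi.sub_apply, Pi.pow_apply, Pi.div_apply, id]
    field_simp
    ring
  have main : k ^ 3 * logDeriv (jA m p) k - k ^ 2 + Complex.I * Q * k / 2
      + 3 * Complex.I * P / 8 / k = k ^ 3 * (deriv e k / (1 + e k)) := by
    rw [de', mul_div_cancel_left₀ _ h1e0]
    field_simp
  rw [main, norm_mul, norm_div, norm_pow]
  calc ‖k‖ ^ 3 * (‖deriv e k‖ / ‖1 + e k‖) ≤ ‖k‖ ^ 3 * (((C / ‖k‖ ^ 5) / (1/2)) / (1/2)) := by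
        gcongr
    _ = _ := by field_simp; norm_num

/-- The holomorphic function to which Cauchy's theorem is applied. -/
noncomputable def jH (G : ℂ → ℂ) (Z : Finset ℂ) (Q : ℝ) (c k : ℂ) : ℂ :=
  k ^ 3 * logDeriv G k + ∑ z ∈ Z, (k ^ 2 + k * z + z ^ 2) - k ^ 2 + Complex.I * Q * k / 2
    + c / (k + Complex.I)

lemma jH_eq (_h : IsJost V L m p) (G : ℂ → ℂ) (hG : Differentiable ℂ G) (Z : Finset ℂ)
    (hA : ∀ k, jA m p k = (∏ z ∈ Z, (k - z)) * G k) (Q : ℝ) (c k : ℂ) (hk : jA m p k ≠ 0) :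
    jH G Z Q c k = k ^ 3 * logDeriv (jA m p) k - k ^ 2 + Complex.I * Q * k / 2
      - ∑ z ∈ Z, z ^ 3 / (k - z) + c / (k + Complex.I) := by
  have hGk : G k ≠ 0 := by
    intro h0; apply hk; rw [hA k, h0, mul_zero]
  have hprod : ∏ z ∈ Z, (k - z) ≠ 0 := by
    intro h0; apply hk; rw [hA k, h0, zero_mul]
  have hz : ∀ z ∈ Z, k - z ≠ 0 := fun z hz => Finset.prod_ne_zero_iff.1 hprod z hz
  have hfun : jA m p = fun k => (∏ z ∈ Z, (k - z)) * G k := funext hA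
  have hl : logDeriv (jA m p) k = ∑ z ∈ Z, 1 / (k - z) + logDeriv G k := by
    rw [hfun, logDeriv_mul k hprod hGk ?_ (hG k)]
    · congr 1
      rw [logDeriv_prod]
      · refine Finset.sum_congr rfl fun z _ => ?_
        simp [logDeriv_apply]
      · exact hz
      · intro i _; fun_prop
    · fun_prop
  rw [hl, mul_add, Finset.mul_sum]
  have : ∑ z ∈ Z, (k ^ 2 + k * z + z ^ 2) = ∑ z ∈ Z, k ^ 3 * (1 / (k - z))
      - ∑ z ∈ Z, z ^ 3 / (k - z) := by
    rw [← Finset.sum_sub_distrib]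
    refine Finset.sum_congr rfl fun z hzz => ?_
    have := hz z hzz
    field_simp
    ring
  unfold jH
  rw [this]
  ring

lemma jH_bound (h : IsJost V L m p) (hV : ContDiff ℝ (⊤ : ℕ∞) V) (Q P : ℝ)
    (hQ : Q = ∫ x in (0:ℝ)..(L+1), V x) (hP : P = ∫ x in (0:ℝ)..(L+1), V x ^ 2)
    (G : ℂ → ℂ) (hG : Differentiable ℂ G) (Z : Finset ℂ)
    (hA : ∀ k, jA m p k = (∏ z ∈ Z, (k - z)) * G k) :
    ∃ C R : ℝ, 1 ≤ R ∧ ∀ k : ℂ, 0 ≤ k.im → R ≤ ‖k‖ →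
      ‖jH G Z Q (3 * Complex.I * P / 8 + ∑ z ∈ Z, z ^ 3) k‖ ≤ C / ‖k‖ ^ 2 := by
  obtain ⟨C, R, hR, key⟩ := h.logA_asym hV Q P hQ hP
  obtain ⟨R2, hR2⟩ := h.A_large hV
  refine ⟨C + ‖(3 * Complex.I * P / 8 : ℂ)‖ + ∑ z ∈ Z, 2 * ‖z ^ 3‖ * ‖z + Complex.I‖,
    max R R2 + 2 * ∑ z ∈ Z, ‖z‖, ?_, ?_⟩
  · have := Finset.sum_nonneg (s := Z) (f := fun z => ‖z‖) (fun z _ => norm_nonneg z)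
    have := le_max_left R R2
    linarith
  intro k hk hkR
  have hs := Finset.sum_nonneg (s := Z) (f := fun z => ‖z‖) (fun z _ => norm_nonneg z)
  have hm1 := le_max_left R R2
  have hm2 := le_max_right R R2
  have hkpos : 0 < ‖k‖ := by linarith
  have hk0 : k ≠ 0 := norm_pos_iff.1 hkpos
  have b1 := key k hk (by linarith)
  have hAk := hR2 k (by linarith) (by linarith)
  have hkI : ‖k‖ ≤ ‖k + Complex.I‖ := by
    rw [Complex.norm_eq_sqrt_sq_add_sq, Complex.norm_eq_sqrt_sq_add_sq]
    apply Real.sqrt_le_sqrt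
    simp
    nlinarith
  have hkI0 : k + Complex.I ≠ 0 := by rw [← norm_pos_iff]; linarith
  rw [h.jH_eq G hG Z hA Q _ k hAk]
  have hzk : ∀ z ∈ Z, ‖k‖ / 2 ≤ ‖k - z‖ := by
    intro z hz
    have h1 := Finset.single_le_sum (f := fun z : ℂ => ‖z‖) (fun z _ => norm_nonneg z) hz
    have h2 := norm_sub_norm_le k z
    linarith
  have split : k ^ 3 * logDeriv (jA m p) k - k ^ 2 + Complex.I * Q * k / 2
      - ∑ z ∈ Z, z ^ 3 / (k - z) + (3 * Complex.I * P / 8 + ∑ z ∈ Z, z ^ 3) / (k + Complex.I)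
      = (k ^ 3 * logDeriv (jA m p) k - k ^ 2 + Complex.I * Q * k / 2 + 3 * Complex.I * P / 8 / k)
        + (3 * Complex.I * P / 8) * (-Complex.I / (k * (k + Complex.I)))
        + ∑ z ∈ Z, z ^ 3 * (-(z + Complex.I)) / ((k + Complex.I) * (k - z)) := by
    have e1 : ∑ z ∈ Z, z ^ 3 * (-(z + Complex.I)) / ((k + Complex.I) * (k - z))
        = (∑ z ∈ Z, z ^ 3) / (k + Complex.I) - ∑ z ∈ Z, z ^ 3 / (k - z) := by
      rw [Finset.sum_div, ← Finset.sum_sub_distrib]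
      refine Finset.sum_congr rfl fun z hz => ?_
      have : k - z ≠ 0 := by
        rw [← norm_pos_iff]; linarith [hzk z hz]
      field_simp
      ring
    have e2 : -Complex.I / (k * (k + Complex.I)) = 1 / (k + Complex.I) - 1 / k := by
      field_simp; ring
    rw [e1, e2]
    ring
  rw [split]
  refine norm_add₃_le.trans ?_
  rw [add_div, add_div]
  gcongr
  · rw [norm_mul, norm_div (-Complex.I), norm_neg, Complex.norm_I, norm_mul k]
    rw [div_eq_mul_one_div (‖(3 * Complex.I * P / 8 : ℂ)‖)]
    rw [sq]
    gcongr
  · refine (norm_sum_le _ _).trans ?_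
    rw [Finset.sum_div]
    refine Finset.sum_le_sum fun z hz => ?_
    have hzk' := hzk z hz
    rw [norm_div, norm_mul, norm_mul, norm_neg]
    calc ‖z ^ 3‖ * ‖z + Complex.I‖ / (‖k + Complex.I‖ * ‖k - z‖)
        ≤ ‖z ^ 3‖ * ‖z + Complex.I‖ / (‖k‖ * (‖k‖ / 2)) := by gcongr
      _ = _ := by field_simp

lemma jH_diff (G : ℂ → ℂ) (hG : Differentiable ℂ G) (Z : Finset ℂ) (Q : ℝ) (c k : ℂ)
    (hk : 0 ≤ k.im) (hGk : G k ≠ 0) : DifferentiableAt ℂ (jH G Z Q c) k := by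
  have h1 : DifferentiableAt ℂ (deriv G) k :=
    (hG.contDiff (n := 2)).differentiable_deriv_two k
  have h2 : DifferentiableAt ℂ (logDeriv G) k := h1.div (hG k) hGk
  have h3 : k + Complex.I ≠ 0 := by
    intro h0
    have := congrArg Complex.im h0
    simp at this
    linarith
  unfold jH
  fun_prop (disch := assumption)

end IsJost

lemma contour_zero (H : ℂ → ℂ) (hd : ∀ k : ℂ, 0 ≤ k.im → DifferentiableAt ℂ H k) (C R0 : ℝ)
    (hb : ∀ k : ℂ, 0 ≤ k.im → R0 ≤ ‖k‖ → ‖H k‖ ≤ C / ‖k‖ ^ 2) :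
    Filter.Tendsto (fun R : ℝ => ∫ x in (-R)..R, H x) Filter.atTop (nhds 0) := by
  have hlim : Filter.Tendsto (fun R : ℝ => 4 * C * R⁻¹) Filter.atTop (nhds 0) := by
    simpa using tendsto_inv_atTop_zero.const_mul (4 * C)
  refine squeeze_zero_norm' ?_ hlim
  filter_upwards [Filter.eventually_ge_atTop (max R0 1)] with R hR
  have hR0 : R0 ≤ R := (le_max_left _ _).trans hR
  have hR1 : 1 ≤ R := (le_max_right _ _).trans hR
  have hC : 0 ≤ C := by
    have := (norm_nonneg _).trans (hb (R:ℂ) (by simp) (by simpa using hR0.trans (le_abs_self R)))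
    by_contra hneg
    have h2 : 0 < ‖(R:ℂ)‖ ^ 2 := by
      have : ‖(R:ℂ)‖ = |R| := by simp
      rw [this]; positivity
    have := div_neg_of_neg_of_pos (not_le.1 hneg) h2
    linarith
  have hbR : ∀ k : ℂ, 0 ≤ k.im → R ≤ ‖k‖ → ‖H k‖ ≤ C / R ^ 2 := by
    intro k h1 h2
    refine (hb k h1 (hR0.trans h2)).trans ?_
    gcongr
  have key := Complex.integral_boundary_rect_eq_zero_of_differentiableOn H (-R : ℂ)
    (R + R * Complex.I) (by
      intro k hk
      rw [Complex.mem_reProdIm] at hk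
      refine (hd k ?_).differentiableWithinAt
      have := hk.2
      simp [uIcc_of_le (by linarith : (0:ℝ) ≤ R)] at this
      exact this.1)
  simp only [Complex.neg_re, Complex.ofReal_re, Complex.add_re, Complex.mul_re, Complex.I_re,
    mul_zero, Complex.ofReal_im, Complex.I_im, mul_one, sub_self, add_zero, Complex.neg_im,
    neg_zero, Complex.ofReal_zero, zero_mul, Complex.add_im, Complex.mul_im, zero_add] at key
  have e1 : ‖∫ x in (-R)..R, H (x + R * Complex.I)‖ ≤ C / R ^ 2 * |R - (-R)| := by
    refine intervalIntegral.norm_integral_le_of_norm_le_const fun x _ => hbR _ (by simp; linarith) ?_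
    have := Complex.abs_im_le_norm (x + R * Complex.I)
    simp at this
    exact (le_abs_self R).trans this
  have e2 : ‖∫ y in (0:ℝ)..R, H (R + y * Complex.I)‖ ≤ C / R ^ 2 * |R - 0| := by
    refine intervalIntegral.norm_integral_le_of_norm_le_const fun y hy => ?_
    rw [uIoc_of_le (by linarith)] at hy
    refine hbR _ (by simp; linarith [hy.1]) ?_
    have := Complex.abs_re_le_norm (R + y * Complex.I)
    simp at this
    exact (le_abs_self R).trans this
  have e3 : ‖∫ y in (0:ℝ)..R, H ((-R : ℝ) + y * Complex.I)‖ ≤ C / R ^ 2 * |R - 0| := by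
    refine intervalIntegral.norm_integral_le_of_norm_le_const fun y hy => ?_
    rw [uIoc_of_le (by linarith)] at hy
    refine hbR _ (by simp; linarith [hy.1]) ?_
    have := Complex.abs_re_le_norm ((-R : ℝ) + y * Complex.I)
    simp at this
    exact (le_abs_self R).trans (by simpa using this)
  have e4 : (∫ x in (-R)..R, H x) = (∫ x in (-R)..R, H (x + R * Complex.I))
      - Complex.I * (∫ y in (0:ℝ)..R, H (R + y * Complex.I))
      + Complex.I * ∫ y in (0:ℝ)..R, H ((-R : ℝ) + y * Complex.I) := by
    simp only [smul_eq_mul] at key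
    linear_combination key
  rw [e4]
  refine (norm_add_le _ _).trans ?_
  refine (add_le_add (norm_sub_le _ _) le_rfl).trans ?_
  rw [norm_mul, norm_mul, Complex.norm_I, one_mul, one_mul]
  refine (add_le_add (add_le_add e1 e2) e3).trans (le_of_eq ?_)
  rw [abs_of_nonneg (by linarith), abs_of_nonneg (by linarith)]
  field_simp
  ring


lemma hasDerivAt_log_norm (A : ℂ → ℂ) (x : ℝ) (hA : DifferentiableAt ℂ A x) (h0 : A x ≠ 0) :
    HasDerivAt (fun t : ℝ => Real.log ‖A t‖) (logDeriv A x).re x := by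
  have h1 : HasDerivAt (fun t : ℝ => A t) (deriv A x) x := hA.hasDerivAt.comp_ofReal
  have hr : HasDerivAt (fun t : ℝ => (A t).re) (deriv A x).re x :=
    Complex.reCLM.hasFDerivAt.comp_hasDerivAt x h1
  have hi : HasDerivAt (fun t : ℝ => (A t).im) (deriv A x).im x :=
    Complex.imCLM.hasFDerivAt.comp_hasDerivAt x h1
  have hpos : 0 < (A x).re * (A x).re + (A x).im * (A x).im := by
    have := Complex.normSq_pos.2 h0
    rwa [Complex.normSq_apply] at this
  have hl := (((hr.mul hr).add (hi.mul hi)).log hpos.ne').const_mul (1/2 : ℝ)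
  have hfun : (fun t : ℝ => Real.log ‖A t‖) = fun t : ℝ => (1/2 : ℝ) *
      Real.log ((A t).re * (A t).re + (A t).im * (A t).im) := by
    funext t
    rw [← Complex.normSq_apply, Complex.normSq_eq_norm_sq, Real.log_pow]
    push_cast; ring
  rw [hfun]
  refine hl.congr_deriv ?_
  rw [logDeriv_apply, Complex.div_re, Complex.normSq_apply]
  simp only [Pi.add_apply, Pi.mul_apply]
  field_simp
  ring

namespace IsJost
variable {V : ℝ → ℝ} {L : ℝ} {m p : ℂ → ℝ → ℂ}

/-- `k² log |a(k)|` on the real line. -/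
noncomputable def jg (m p : ℂ → ℝ → ℂ) (x : ℝ) : ℝ := Real.log ‖jA m p x / x‖ * x ^ 2

lemma A_real_ne (h : IsJost V L m p) (x : ℝ) (hx : x ≠ 0) : jA m p x ≠ 0 := by
  have := h.A_real_ge x
  rw [← norm_pos_iff]
  exact (abs_pos.2 hx).trans_le this

lemma one_le_a (h : IsJost V L m p) (x : ℝ) (hx : x ≠ 0) : 1 ≤ ‖jA m p x / x‖ := by
  rw [norm_div, Complex.norm_real, Real.norm_eq_abs, one_le_div (abs_pos.2 hx)]
  exact h.A_real_ge x

lemma jg_nonneg (h : IsJost V L m p) (x : ℝ) : 0 ≤ jg m p x := by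
  by_cases hx : x = 0
  · simp [jg, hx]
  · have := Real.log_nonneg (h.one_le_a x hx)
    unfold jg; positivity

lemma jg_le (_h : IsJost V L m p) (x : ℝ) : jg m p x ≤ |x| * ‖jA m p x‖ := by
  by_cases hx : x = 0
  · simp [jg, hx]
  · have h1 := Real.log_le_self (x := ‖jA m p x / x‖) (norm_nonneg _)
    unfold jg
    calc _ ≤ ‖jA m p x / x‖ * x ^ 2 := by gcongr
      _ = _ := by
        rw [norm_div, Complex.norm_real, Real.norm_eq_abs, ← sq_abs]
        have := abs_pos.2 hx
        field_simp

lemma jg_hasDerivAt (h : IsJost V L m p) (x : ℝ) (hx : x ≠ 0) :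
    HasDerivAt (fun t : ℝ => Real.log ‖jA m p t / t‖) ((logDeriv (jA m p) x).re - 1 / x) x := by
  have h1 := hasDerivAt_log_norm (jA m p) x (h.diffA x) (h.A_real_ne x hx)
  have h2 := h1.sub (Real.hasDerivAt_log hx)
  have heq : (fun t : ℝ => Real.log ‖jA m p t / t‖) =ᶠ[nhds x]
      ((fun t : ℝ => Real.log ‖jA m p t‖) - Real.log) := by
    filter_upwards [isOpen_ne.mem_nhds hx] with t ht
    rw [norm_div, Real.log_div (norm_ne_zero_iff.2 (h.A_real_ne t ht)) (by simpa using ht)]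
    simp
  refine (h2.congr_of_eventuallyEq heq).congr_deriv ?_
  rw [one_div]

lemma jg_cont (h : IsJost V L m p) : Continuous (jg m p) := by
  rw [continuous_iff_continuousAt]
  intro x
  by_cases hx : x = 0
  · subst hx
    have h0 : jg m p 0 = 0 := by simp [jg]
    rw [ContinuousAt, h0]
    have hc : Continuous (fun x : ℝ => |x| * ‖jA m p x‖) := by
      have := h.diffA.continuous
      fun_prop
    have := hc.tendsto 0
    simp only [abs_zero, zero_mul] at this
    exact squeeze_zero (fun x => h.jg_nonneg x) (fun x => h.jg_le x) this
  · unfold jg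
    exact (h.jg_hasDerivAt x hx).continuousAt.mul (by fun_prop)

lemma jg_decay (h : IsJost V L m p) (hV : ContDiff ℝ (⊤ : ℕ∞) V) :
    ∃ C R : ℝ, 1 ≤ R ∧ 0 ≤ C ∧ ∀ x : ℝ, R ≤ |x| → jg m p x ≤ C / |x| ^ 3 := by
  obtain ⟨C, R, hR, hC, key⟩ := h.asym2 hV _ _ rfl rfl
  refine ⟨C, R, hR, hC, fun x hx => ?_⟩
  have hx1 : 0 < |x| := by linarith
  have hx0 : x ≠ 0 := abs_pos.1 hx1
  have hxc : (x:ℂ) ≠ 0 := by exact_mod_cast hx0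
  have hz : 2 * Complex.I * (x:ℂ) * ((-(1 / (2 * x)) : ℝ) * Complex.I) = 1 := by
    push_cast
    field_simp
    linear_combination (-1 : ℂ) * Complex.I_sq
  have := key x _ (by simp) (by simpa using hx) hz
  set y : ℝ := -(1 / (2 * x)) with hy
  set Q := ∫ x in (0:ℝ)..(L+1), V x
  set P := ∫ x in (0:ℝ)..(L+1), V x ^ 2
  have hE : ((Q:ℂ) * (y * Complex.I) - P * (y * Complex.I) ^ 3) =
      ((Q * y + P * y ^ 3 : ℝ) : ℂ) * Complex.I := by
    push_cast
    linear_combination (-(P:ℂ) * y ^ 3 * Complex.I) * Complex.I_sq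
  rw [hE] at this
  have h2 := norm_sub_norm_le (jA m p x / x * Complex.exp (((Q * y + P * y ^ 3 : ℝ) : ℂ) * Complex.I)) 1
  rw [norm_mul, Complex.norm_exp_ofReal_mul_I, mul_one, norm_one] at h2
  have hyn : ‖(y:ℂ) * Complex.I‖ ≤ 1 / |x| := by
    rw [norm_mul, Complex.norm_I, mul_one, Complex.norm_real, hy, norm_neg, Real.norm_eq_abs,
      abs_div, abs_mul, abs_one]
    gcongr
    rw [abs_two]; linarith
  have h3 : ‖(y:ℂ) * Complex.I‖ ^ 5 ≤ (1 / |x|) ^ 5 := by gcongr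
  have h4 := Real.log_le_sub_one_of_pos (x := ‖jA m p x / x‖) (by linarith [h.one_le_a x hx0])
  have h5 : C * ‖(y:ℂ) * Complex.I‖ ^ 5 ≤ C * (1 / |x|) ^ 5 := by gcongr
  unfold jg
  calc _ ≤ (C * (1 / |x|) ^ 5) * |x| ^ 2 := by
        rw [sq_abs]; gcongr; linarith
    _ = _ := by field_simp

lemma jg_integrable (h : IsJost V L m p) (hV : ContDiff ℝ (⊤ : ℕ∞) V) :
    Integrable (jg m p) := by
  obtain ⟨C, R, hR, hC, key⟩ := h.jg_decay hV
  obtain ⟨B, hB⟩ := (isCompact_Icc (a := -R) (b := R)).exists_bound_of_continuousOn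
    (f := fun x => jg m p x * (1 + x ^ 2)) (by
      have := h.jg_cont
      fun_prop)
  have hB0 : 0 ≤ B := (norm_nonneg _).trans (hB 0 (by constructor <;> linarith))
  refine (integrable_inv_one_add_sq.const_mul (B + 2 * C)).mono'
    h.jg_cont.aestronglyMeasurable (Filter.Eventually.of_forall fun x => ?_)
  rw [Real.norm_of_nonneg (h.jg_nonneg x), ← div_eq_mul_inv, le_div_iff₀ (by positivity)]
  by_cases hx : |x| ≤ R
  · have := hB x (abs_le.1 hx)
    have := (le_abs_self _).trans this
    linarith
  · push Not at hx
    have hx1 : 1 ≤ |x| := by linarith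
    have h1 := key x hx.le
    calc jg m p x * (1 + x ^ 2) ≤ (C / |x| ^ 3) * (|x| ^ 3 + |x| ^ 3) := by
          rw [← sq_abs]
          gcongr
          · exact one_le_pow₀ hx1
          · norm_num
      _ = 2 * C := by
          field_simp; ring
      _ ≤ _ := by linarith

end IsJost


lemma tendsto_arctan_div (κ : ℝ) (hκ : 0 ≤ κ) :
    Filter.Tendsto (fun R : ℝ => κ ^ 3 * Real.arctan (R / κ)) Filter.atTop
      (nhds (κ ^ 3 * (π / 2))) := by
  rcases hκ.eq_or_lt with h0 | h0
  · subst h0; simp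
  · refine Filter.Tendsto.const_mul _ ?_
    refine (Real.tendsto_arctan_atTop.mono_right nhdsWithin_le_nhds).comp ?_
    exact Filter.tendsto_id.atTop_div_const h0

lemma hasDerivAt_arctan_div (κ x : ℝ) (hx : x ≠ 0) :
    HasDerivAt (fun t : ℝ => κ ^ 3 * Real.arctan (t / κ)) (κ ^ 4 / (x ^ 2 + κ ^ 2)) x := by
  by_cases h0 : κ = 0
  · subst h0
    simpa using hasDerivAt_const x (0:ℝ)
  · have := (((hasDerivAt_id x).div_const κ).arctan).const_mul (κ ^ 3)
    refine this.congr_deriv ?_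
    have : x ^ 2 + κ ^ 2 ≠ 0 := by positivity
    have : 1 + (x / κ) ^ 2 ≠ 0 := by positivity
    simp only [id]
    field_simp
    ring

namespace IsJost
variable {V : ℝ → ℝ} {L : ℝ} {m p : ℂ → ℝ → ℂ}

lemma sum_rule_Z (h : IsJost V L m p) (hV : ContDiff ℝ (⊤ : ℕ∞) V) (P : ℝ)
    (hP : P = ∫ x in (0:ℝ)..(L+1), V x ^ 2) :
    ∃ Z : Finset ℂ, (∀ z, z ∈ Z ↔ 0 ≤ z.im ∧ jA m p z = 0) ∧ (∀ z ∈ Z, z.re = 0) ∧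
      (∫ x, jg m p x) + (2 * π / 3) * ∑ z ∈ Z, z.im ^ 3 = π / 8 * P := by
  obtain ⟨Z, G, hG, hZ, hA, hG0⟩ := h.factor hV
  have hre : ∀ z ∈ Z, z.re = 0 := by
    intro z hz
    by_contra hne
    exact h.A_ne_zero_of_re z ((hZ z).1 hz).1 hne ((hZ z).1 hz).2
  refine ⟨Z, hZ, hre, ?_⟩
  set Q := ∫ x in (0:ℝ)..(L+1), V x with hQ
  obtain ⟨C, R0, hR0, hb⟩ := h.jH_bound hV Q P hQ hP G hG Z hA
  set σ := ∑ z ∈ Z, z.im ^ 3 with hσ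
  set γ := 3 * P / 8 - σ with hγ
  have hz3 : ∀ z ∈ Z, z = z.im * Complex.I := by
    intro z hz
    apply Complex.ext <;> simp [hre z hz]
  have hc : (3 * Complex.I * P / 8 + ∑ z ∈ Z, z ^ 3 : ℂ) = Complex.I * γ := by
    have : ∑ z ∈ Z, z ^ 3 = - Complex.I * (σ : ℂ) := by
      rw [hσ]; push_cast
      rw [Finset.mul_sum]
      refine Finset.sum_congr rfl fun z hz => ?_
      conv_lhs => rw [hz3 z hz]
      rw [mul_pow, Complex.I_pow_three]; ring
    rw [this, hγ]; push_cast; ring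
  rw [hc] at hb
  set H := jH G Z Q (Complex.I * γ) with hH
  have hHd : ∀ k : ℂ, 0 ≤ k.im → DifferentiableAt ℂ H k := fun k hk =>
    jH_diff G hG Z Q _ k hk (hG0 k hk)
  have hlim := contour_zero H hHd C R0 hb
  have hHc : Continuous (fun x : ℝ => H x) := by
    rw [continuous_iff_continuousAt]
    intro x
    exact ContinuousAt.comp (g := H) (hHd x (by simp)).continuousAt
      Complex.continuous_ofReal.continuousAt
  -- the primitive
  set F : ℝ → ℝ := fun x => x * jg m p x - ∑ z ∈ Z, z.im ^ 3 * Real.arctan (x / z.im)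
    + γ * Real.arctan x with hF
  have hFc : Continuous F := by
    have := h.jg_cont
    have := Real.continuous_arctan
    have h2 : Continuous fun x => ∑ z ∈ Z, z.im ^ 3 * Real.arctan (x / z.im) :=
      continuous_finsetSum _ fun z _ => by fun_prop
    fun_prop
  have hFd : ∀ x : ℝ, x ≠ 0 → HasDerivAt F (3 * jg m p x + (H x).re) x := by
    intro x hx
    have d1 := (h.jg_hasDerivAt x hx).mul ((hasDerivAt_id x).pow 3)
    have d2 := HasDerivAt.fun_sum (u := Z)
      (A := fun z : ℂ => fun x : ℝ => z.im ^ 3 * Real.arctan (x / z.im))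
      (fun z _ => hasDerivAt_arctan_div z.im x hx)
    have d3 := (Real.hasDerivAt_arctan x).const_mul γ
    have d := (d1.sub d2).add d3
    have hFe : F = fun t : ℝ => Real.log ‖jA m p t / t‖ * t ^ 3
        - ∑ z ∈ Z, z.im ^ 3 * Real.arctan (t / z.im) + γ * Real.arctan t := by
      funext t
      simp only [hF, jg]
      ring
    rw [hFe]
    refine HasDerivAt.congr_deriv d ?_
    have hHx : H x = _ := h.jH_eq G hG Z hA Q (Complex.I * γ) x (h.A_real_ne x hx)
    have r1 : (∑ z ∈ Z, z ^ 3 / ((x:ℂ) - z)).re = ∑ z ∈ Z, z.im ^ 4 / (x ^ 2 + z.im ^ 2) := by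
      rw [Complex.re_sum]
      refine Finset.sum_congr rfl fun z hz => ?_
      set κ := z.im with hκ
      have hzz : z = κ * Complex.I := hz3 z hz
      have hd : (x:ℂ) ^ 2 + (κ:ℂ) ^ 2 ≠ 0 := by
        have : x ^ 2 + κ ^ 2 ≠ 0 := by positivity
        exact_mod_cast this
      have hfac : ((x:ℂ) - κ * Complex.I) * (x + κ * Complex.I) = x ^ 2 + κ ^ 2 := by
        linear_combination (-(κ:ℂ) ^ 2) * Complex.I_sq
      have hd2 : (x:ℂ) - κ * Complex.I ≠ 0 := by
        intro h0; rw [h0, zero_mul] at hfac; exact hd hfac.symm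
      have : z ^ 3 / ((x:ℂ) - z) = ((κ ^ 4 / (x ^ 2 + κ ^ 2) : ℝ) : ℂ)
          + ((-(κ ^ 3 * x) / (x ^ 2 + κ ^ 2) : ℝ) : ℂ) * Complex.I := by
        rw [hzz, mul_pow, Complex.I_pow_three]
        push_cast
        rw [div_eq_iff hd2]
        field_simp
        linear_combination ((κ:ℂ) ^ 4 * x * Complex.I - (κ:ℂ)^4 * x * Complex.I + (-(κ:ℂ)^4*x)) * Complex.I_sq
      rw [this, Complex.add_re, Complex.re_ofReal_mul, Complex.ofReal_re, Complex.I_re]; ring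
    have r2 : (Complex.I * (γ:ℂ) / (x + Complex.I)).re = γ / (1 + x ^ 2) := by
      rw [Complex.div_re]
      simp [Complex.normSq_apply]
      ring
    have r3 : (Complex.I * (Q:ℂ) * x / 2).re = 0 := by simp
    have r4 : ((x:ℂ) ^ 3 * logDeriv (jA m p) x).re = x ^ 3 * (logDeriv (jA m p) x).re := by
      rw [← Complex.ofReal_pow, Complex.re_ofReal_mul]
    have r5 : ((x:ℂ) ^ 2).re = x ^ 2 := by
      rw [← Complex.ofReal_pow, Complex.ofReal_re]
    rw [hHx]
    simp only [Complex.add_re, Complex.sub_re, r1, r2, r3, r4, r5]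
    simp only [jg, Pi.pow_apply, id]
    field_simp
    push_cast
    ring
  have hgi := h.jg_integrable hV
  have hftc : ∀ R : ℝ, 3 * (∫ x in (-R)..R, jg m p x) + (∫ x in (-R)..R, H x).re
      = F R - F (-R) := by
    intro R
    have i1 : IntervalIntegrable (fun x => 3 * jg m p x) volume (-R) R :=
      (Continuous.intervalIntegrable (by have := h.jg_cont; fun_prop) _ _)
    have i2 : IntervalIntegrable (fun x : ℝ => (H x).re) volume (-R) R :=
      (Complex.continuous_re.comp hHc).intervalIntegrable _ _
    have := MeasureTheory.integral_eq_of_hasDerivAt_off_countable F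
      (fun x => 3 * jg m p x + (H x).re) (a := -R) (b := R) (s := {0}) (countable_singleton 0)
      hFc.continuousOn (fun x hx => hFd x (by simpa using hx.2)) (i1.add i2)
    rw [← this, intervalIntegral.integral_add i1 i2, intervalIntegral.integral_const_mul]
    congr 1
    exact (Complex.reCLM.intervalIntegral_comp_comm (hHc.intervalIntegrable (-R) R)).symm
  have lim1 : Filter.Tendsto (fun R : ℝ => 3 * (∫ x in (-R)..R, jg m p x)
      + (∫ x in (-R)..R, H x).re) Filter.atTop (nhds (3 * (∫ x, jg m p x) + 0)) := by
    refine Filter.Tendsto.add ?_ ?_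
    · exact (intervalIntegral_tendsto_integral hgi Filter.tendsto_neg_atTop_atBot
        Filter.tendsto_id).const_mul 3
    · have h0 := (Complex.continuous_re.tendsto 0).comp hlim
      rw [Complex.zero_re] at h0
      exact h0
  obtain ⟨C1, R1, hR1, hC1, hdec⟩ := h.jg_decay hV
  have hinv : Filter.Tendsto (fun R : ℝ => C1 * R⁻¹) Filter.atTop (nhds 0) := by
    simpa using tendsto_inv_atTop_zero.const_mul C1
  have small : ∀ x : ℝ, R1 ≤ |x| → ‖x * jg m p x‖ ≤ C1 * |x|⁻¹ := by
    intro x hx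
    have hx1 : 1 ≤ |x| := by linarith
    rw [norm_mul, Real.norm_eq_abs, Real.norm_of_nonneg (h.jg_nonneg x)]
    calc |x| * jg m p x ≤ |x| * (C1 / |x| ^ 3) := by
          gcongr; exact hdec x hx
      _ = C1 * (|x| ^ 2)⁻¹ := by field_simp
      _ ≤ C1 * |x|⁻¹ := by
          gcongr
          exact le_self_pow₀ hx1 (by norm_num)
  have l1 : Filter.Tendsto (fun R : ℝ => R * jg m p R) Filter.atTop (nhds 0) := by
    refine squeeze_zero_norm' ?_ hinv
    filter_upwards [Filter.eventually_ge_atTop R1] with R hR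
    have hRp : |R| = R := abs_of_nonneg (by linarith)
    have := small R (by rwa [hRp])
    rwa [hRp] at this
  have l2 : Filter.Tendsto (fun R : ℝ => (-R) * jg m p (-R)) Filter.atTop (nhds 0) := by
    refine squeeze_zero_norm' ?_ hinv
    filter_upwards [Filter.eventually_ge_atTop R1] with R hR
    have hRp : |-R| = R := by rw [abs_neg]; exact abs_of_nonneg (by linarith)
    have := small (-R) (by rwa [hRp])
    rwa [hRp] at this
  have l3 : Filter.Tendsto (fun R : ℝ => ∑ z ∈ Z, z.im ^ 3 * Real.arctan (R / z.im)) Filter.atTop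
      (nhds (∑ z ∈ Z, z.im ^ 3 * (π / 2))) :=
    tendsto_finsetSum _ fun z hz => tendsto_arctan_div z.im ((hZ z).1 hz).1
  have l4 : Filter.Tendsto (fun R : ℝ => γ * Real.arctan R) Filter.atTop (nhds (γ * (π / 2))) :=
    (Real.tendsto_arctan_atTop.mono_right nhdsWithin_le_nhds).const_mul γ
  have lim2 : Filter.Tendsto (fun R : ℝ => F R - F (-R)) Filter.atTop
      (nhds (0 - 0 - 2 * (∑ z ∈ Z, z.im ^ 3 * (π / 2)) + 2 * (γ * (π / 2)))) := by
    refine (((l1.sub l2).sub (l3.const_mul 2)).add (l4.const_mul 2)).congr fun R => ?_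
    simp only [hF, neg_div, Real.arctan_neg, mul_neg, Finset.sum_neg_distrib]
    ring
  have huniq := tendsto_nhds_unique (lim1.congr hftc) lim2
  rw [← Finset.sum_mul, ← hσ, hγ] at huniq
  linear_combination huniq / 3

end IsJost


lemma contDiff_two_of (u u1 u2 : ℝ → ℝ) (hu : ∀ x, HasDerivAt u (u1 x) x)
    (hu1 : ∀ x, HasDerivAt u1 (u2 x) x) (hc : Continuous u2) : ContDiff ℝ 2 u := by
  have e1 : deriv u = u1 := funext fun x => (hu x).deriv
  have e2 : deriv u1 = u2 := funext fun x => (hu1 x).deriv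
  rw [show (2 : WithTop ℕ∞) = 1 + 1 by norm_num, contDiff_succ_iff_deriv]
  refine ⟨fun x => (hu x).differentiableAt, by simp, ?_⟩
  rw [e1, contDiff_one_iff_deriv, e2]
  exact ⟨fun x => (hu1 x).differentiableAt, hc⟩

lemma const_left {E : Type*} [NormedAddCommGroup E] [NormedSpace ℝ E] (q : ℝ → E)
    (hc : Continuous q) (hd : ∀ x < (0:ℝ), HasDerivAt q 0 x) : ∀ x ≤ 0, q x = q 0 := by
  intro x hx
  have := constant_of_has_deriv_right_zero (f := q) (a := x) (b := 0) hc.continuousOn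
    (fun t ht => (hd t ht.2).hasDerivWithinAt) 0 ⟨hx, le_rfl⟩
  exact this.symm

lemma left_decay (κ : ℝ) (hκ : 0 < κ) (u u1 : ℝ → ℝ) (hu : ∀ x, HasDerivAt u (u1 x) x)
    (hc1 : Continuous u1) (hu1 : ∀ x < (0:ℝ), HasDerivAt u1 (κ ^ 2 * u x) x)
    (hintg : Integrable (fun x => u x ^ 2)) : u1 0 = κ * u 0 := by
  have hcu : Continuous u := continuous_iff_continuousAt.2 fun x => (hu x).continuousAt
  have ha : ∀ x ≤ (0:ℝ), (u1 x + κ * u x) * Real.exp (-(κ * x)) = u1 0 + κ * u 0 := by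
    intro x hx
    have := const_left (fun x => (u1 x + κ * u x) * Real.exp (-(κ * x))) (by fun_prop) (by
      intro x hx
      have de : HasDerivAt (fun x : ℝ => Real.exp (-(κ * x))) (Real.exp (-(κ * x)) * (-κ)) x := by
        have : HasDerivAt (fun x : ℝ => -(κ * x)) (-κ) x := by
          exact (((hasDerivAt_id x).const_mul κ).neg).congr_deriv (by simp)
        exact this.exp
      refine (((hu1 x hx).add ((hu x).const_mul κ)).mul de).congr_deriv ?_
      simp only [Pi.add_apply]
      ring) x hx
    simpa using this
  have hb : ∀ x ≤ (0:ℝ), (u1 x - κ * u x) * Real.exp (κ * x) = u1 0 - κ * u 0 := by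
    intro x hx
    have := const_left (fun x => (u1 x - κ * u x) * Real.exp (κ * x)) (by fun_prop) (by
      intro x hx
      have de : HasDerivAt (fun x : ℝ => Real.exp (κ * x)) (Real.exp (κ * x) * κ) x := by
        have : HasDerivAt (fun x : ℝ => κ * x) κ x := by
          simpa using (hasDerivAt_id x).const_mul κ
        exact this.exp
      refine (((hu1 x hx).sub ((hu x).const_mul κ)).mul de).congr_deriv ?_
      simp only [Pi.sub_apply]
      ring) x hx
    simpa using this
  set α := u1 0 + κ * u 0
  set β := u1 0 - κ * u 0 with hβ
  suffices β = 0 by linarith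
  have hbound : ∀ x ≤ (0:ℝ), β ^ 2 ≤ 8 * κ ^ 2 * u x ^ 2 + 2 * α ^ 2 * Real.exp (2 * κ * x) := by
    intro x hx
    have e1 := ha x hx
    have e2 := hb x hx
    set s := Real.exp (κ * x) with hs
    have hspos : 0 < s := Real.exp_pos _
    have hs1 : s ≤ 1 := by
      rw [hs, Real.exp_le_one_iff]; nlinarith
    rw [Real.exp_neg, ← hs] at e1
    have e3 : Real.exp (2 * κ * x) = s ^ 2 := by
      rw [hs, ← Real.exp_nat_mul]; congr 1; push_cast; ring
    rw [e3]
    have e1' : u1 x + κ * u x = α * s := by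
      rw [← e1]; field_simp
    have h2 : β = (α * s - 2 * κ * u x) * s := by rw [← e2, ← e1']; ring
    have h3 : β ^ 2 ≤ (α * s - 2 * κ * u x) ^ 2 := by
      rw [h2, mul_pow]
      have : s ^ 2 ≤ 1 := by nlinarith
      nlinarith [sq_nonneg (α * s - 2 * κ * u x)]
    nlinarith [sq_nonneg (α * s + 2 * κ * u x)]
  have hi : IntegrableOn (fun _ : ℝ => β ^ 2) (Iic (0:ℝ)) := by
    refine Integrable.mono' (((hintg.integrableOn (s := Iic (0:ℝ))).const_mul (8 * κ ^ 2)).add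
      ((integrableOn_exp_mul_Iic (a := 2 * κ) (by linarith) 0).const_mul (2 * α ^ 2)))
      aestronglyMeasurable_const ?_
    filter_upwards [ae_restrict_mem measurableSet_Iic] with x hx
    rw [Real.norm_of_nonneg (sq_nonneg _)]
    exact hbound x hx
  rw [integrableOn_const_iff] at hi
  rcases hi with h0 | h0
  · exact pow_eq_zero_iff (two_ne_zero) |>.1 (by simpa using h0)
  · simp at h0

lemma right_decay (κ : ℝ) (hκ : 0 < κ) (M : ℝ) (u u1 : ℝ → ℝ) (hu : ∀ x, HasDerivAt u (u1 x) x)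
    (hc1 : Continuous u1) (hu1 : ∀ x > M, HasDerivAt u1 (κ ^ 2 * u x) x)
    (hintg : Integrable (fun x => u x ^ 2)) : u1 M = - κ * u M := by
  have := left_decay κ hκ (fun x => u (M - x)) (fun x => - u1 (M - x)) (fun x => ?_)
    (by fun_prop) (fun x hx => ?_) (hintg.comp_sub_left M)
  · simp only [sub_zero] at this
    linarith
  · exact ((hu (M - x)).comp_const_sub M x)
  · have h1 := (hu1 (M - x) (by linarith)).comp_const_sub M x
    refine h1.neg.congr_deriv ?_
    ring

namespace IsJost
variable {V : ℝ → ℝ} {L : ℝ} {m p : ℂ → ℝ → ℂ}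

lemma dexp (κ x : ℝ) : HasDerivAt (fun x : ℝ => ((Real.exp (-(κ * x)) : ℝ) : ℂ))
    ((Real.exp (-(κ * x)) : ℝ) * (-κ : ℂ)) x := by
  have : HasDerivAt (fun x : ℝ => -(κ * x)) (-κ) x := by
    exact (((hasDerivAt_id x).const_mul κ).neg).congr_deriv (by simp)
  refine this.exp.ofReal_comp.congr_deriv ?_
  push_cast; ring

lemma jost_y (h : IsJost V L m p) (κ : ℝ) (x : ℝ) :
    HasDerivAt (fun x : ℝ => m (κ * Complex.I) x * (Real.exp (-(κ * x)) : ℝ))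
      ((p (κ * Complex.I) x - κ * m (κ * Complex.I) x) * (Real.exp (-(κ * x)) : ℝ)) x ∧
    HasDerivAt (fun x : ℝ => (p (κ * Complex.I) x - κ * m (κ * Complex.I) x) *
        (Real.exp (-(κ * x)) : ℝ))
      (((V x + κ ^ 2 : ℝ) : ℂ) * (m (κ * Complex.I) x * (Real.exp (-(κ * x)) : ℝ))) x := by
  have hm := h.dm (κ * Complex.I) x
  have hp := h.dp (κ * Complex.I) x
  constructor
  · refine (hm.mul (dexp κ x)).congr_deriv ?_
    ring
  · refine ((hp.sub (hm.const_mul (κ:ℂ))).mul (dexp κ x)).congr_deriv ?_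
    simp only [Pi.sub_apply]
    push_cast
    linear_combination (-2 * (κ:ℂ) * p (κ * Complex.I) x * Complex.exp (-(κ * x))) * Complex.I_sq

lemma eig_of_zero (h : IsJost V L m p) (E κ : ℝ) (hκ : 0 < κ) (hE : E = -κ ^ 2)
    (hA : jA m p (κ * Complex.I) = 0) : ∃ u : ℝ → ℝ,
      ContDiff ℝ 2 u ∧ (∃ x : ℝ, u x ≠ 0) ∧
      (∀ x : ℝ, -(deriv (deriv u) x) + V x * u x = E * u x) ∧
      Integrable (fun x => u x ^ 2) := by
  set k : ℂ := κ * Complex.I with hk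
  set y : ℝ → ℂ := fun x => m k x * (Real.exp (-(κ * x)) : ℝ) with hy
  set y1 : ℝ → ℂ := fun x => (p k x - κ * m k x) * (Real.exp (-(κ * x)) : ℝ) with hy1
  have dy : ∀ x, HasDerivAt y (y1 x) x := fun x => (h.jost_y κ x).1
  have dy1 : ∀ x, HasDerivAt y1 (((V x + κ ^ 2 : ℝ) : ℂ) * y x) x := fun x => (h.jost_y κ x).2
  have du : ∀ x, HasDerivAt (fun x => (y x).re) (y1 x).re x := fun x =>
    Complex.reCLM.hasFDerivAt.comp_hasDerivAt x (dy x)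
  have du1 : ∀ x, HasDerivAt (fun x => (y1 x).re) ((V x + κ ^ 2) * (y x).re) x := fun x => by
    refine (Complex.reCLM.hasFDerivAt.comp_hasDerivAt x (dy1 x)).congr_deriv ?_
    rw [Complex.reCLM_apply, Complex.re_ofReal_mul]
  have hcu : Continuous (fun x => (y x).re) :=
    continuous_iff_continuousAt.2 fun x => (du x).continuousAt
  have hright : ∀ x ≥ L, (y x).re = Real.exp (-(κ * x)) := by
    intro x hx
    simp only [hy]
    rw [(h.hend k x hx).1, one_mul, Complex.ofReal_re]
  have hVz : ∀ x < (0:ℝ), V x = 0 := fun x hx => h.hs x (fun hm => by linarith [hm.1])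
  have h2A := two_I_jA (m := m) (p := p) k
  rw [hA, mul_zero] at h2A
  have hIk : 2 * Complex.I * k = -2 * κ := by
    rw [hk]; linear_combination (2 * (κ:ℂ)) * Complex.I_sq
  rw [hIk] at h2A
  have hq : ∀ x ≤ (0:ℝ), p k x = 2 * κ * m k x := by
    intro x hx
    have := const_left (fun x => p k x - 2 * κ * m k x)
      ((h.cp k).sub (continuous_const.mul (h.cm k))) (by
        intro x hx
        refine ((h.dp k x).sub ((h.dm k x).const_mul (2 * (κ:ℂ)))).congr_deriv ?_
        rw [hIk, hVz x hx]; push_cast; ring) x hx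
    linear_combination this - h2A
  have hleft : ∀ x ≤ (0:ℝ), (y x).re = (y 0).re * Real.exp (κ * x) := by
    intro x hx
    have := const_left (fun x => y x * (Real.exp (-(κ * x)) : ℝ))
      (by
        have hcy : Continuous y := continuous_iff_continuousAt.2 fun x => (dy x).continuousAt
        fun_prop) (by
        intro x hx
        refine ((dy x).mul (dexp κ x)).congr_deriv ?_
        simp only [hy1, hy, hq x hx.le]
        ring) x hx
    simp only [mul_zero, neg_zero, Real.exp_zero, Complex.ofReal_one, mul_one] at this
    rw [← this, mul_comm (y x), Complex.re_ofReal_mul, mul_comm, ← mul_assoc, ← Real.exp_add]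
    simp
  refine ⟨fun x => (y x).re, contDiff_two_of _ _ _ du du1 ?_, ⟨L, ?_⟩, ?_, ?_⟩
  · have := h.contV
    fun_prop
  · simp only [hright L le_rfl]
    exact (Real.exp_pos _).ne'
  · intro x
    have e1 : deriv (fun x => (y x).re) = fun x => (y1 x).re := funext fun x => (du x).deriv
    rw [e1, (du1 x).deriv, hE]
    ring
  · rw [← integrableOn_univ, ← Iic_union_Ioi (a := (0:ℝ)), integrableOn_union,
      ← Ioc_union_Ioi_eq_Ioi h.hL.le, integrableOn_union]
    refine ⟨?_, ?_, ?_⟩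
    · have : IntegrableOn (fun x => (y 0).re ^ 2 * Real.exp (2 * κ * x)) (Iic 0) :=
        (integrableOn_exp_mul_Iic (a := 2 * κ) (by linarith) 0).const_mul ((y 0).re ^ 2)
      refine this.congr_fun (fun x hx => ?_) measurableSet_Iic
      simp only
      rw [hleft x hx, mul_pow, ← Real.exp_nat_mul]
      congr 2; push_cast; ring
    · exact ((hcu.pow 2).integrableOn_Icc).mono_set Ioc_subset_Icc_self
    · have := exp_neg_integrableOn_Ioi L (b := 2 * κ) (by linarith)
      refine this.congr_fun (fun x hx => ?_) measurableSet_Ioi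
      simp only
      rw [hright x (le_of_lt hx), ← Real.exp_nat_mul]
      congr 1; push_cast; ring

lemma zero_of_eig (h : IsJost V L m p) (E κ : ℝ) (hκ : 0 < κ) (hE : E = -κ ^ 2)
    (u : ℝ → ℝ) (hu : ContDiff ℝ 2 u) (hne : ∃ x : ℝ, u x ≠ 0)
    (hode : ∀ x : ℝ, -(deriv (deriv u) x) + V x * u x = E * u x)
    (hintg : Integrable (fun x => u x ^ 2)) : jA m p (κ * Complex.I) = 0 := by
  set k : ℂ := κ * Complex.I with hk
  set y : ℝ → ℂ := fun x => m k x * (Real.exp (-(κ * x)) : ℝ) with hy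
  set y1 : ℝ → ℂ := fun x => (p k x - κ * m k x) * (Real.exp (-(κ * x)) : ℝ) with hy1
  have dy : ∀ x, HasDerivAt y (y1 x) x := fun x => (h.jost_y κ x).1
  have dy1 : ∀ x, HasDerivAt y1 (((V x + κ ^ 2 : ℝ) : ℂ) * y x) x := fun x => (h.jost_y κ x).2
  have du : ∀ x, HasDerivAt u (deriv u x) x := fun x =>
    (hu.differentiable (by norm_num) x).hasDerivAt
  have du1 : ∀ x, HasDerivAt (deriv u) ((V x + κ ^ 2) * u x) x := fun x => by
    have := (hu.differentiable_deriv_two x).hasDerivAt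
    refine this.congr_deriv ?_
    have := hode x
    rw [hE] at this
    linarith
  have hc1 : Continuous (deriv u) := continuous_iff_continuousAt.2 fun x => (du1 x).continuousAt
  have h0 : deriv u 0 = κ * u 0 := by
    refine left_decay κ hκ u (deriv u) du hc1 (fun x hx => ?_) hintg
    have := du1 x
    rwa [h.hs x (fun hm => by linarith [hm.1]), zero_add] at this
  have hL : deriv u L = -κ * u L := by
    refine right_decay κ hκ L u (deriv u) du hc1 (fun x hx => ?_) hintg
    have := du1 x
    rwa [h.hs x (fun hm => by linarith [hm.2]), zero_add] at this
  set W : ℝ → ℂ := fun x => (u x : ℂ) * y1 x - ((deriv u x : ℝ) : ℂ) * y x with hW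
  have dW : ∀ x, HasDerivAt W 0 x := by
    intro x
    refine (((du x).ofReal_comp.mul (dy1 x)).sub ((du1 x).ofReal_comp.mul (dy x))).congr_deriv ?_
    push_cast; ring
  have hconst : W 0 = W L := is_const_of_deriv_eq_zero (fun x => (dW x).differentiableAt)
    (fun x => (dW x).deriv) 0 L
  have hWL : W L = 0 := by
    simp only [hW, hy, hy1, hL, (h.hend k L le_rfl).1, (h.hend k L le_rfl).2]
    push_cast; ring
  have hW0 : W 0 = u 0 * (2 * Complex.I * jA m p k) := by
    rw [two_I_jA]
    simp only [hW, hy, hy1, h0]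
    simp only [mul_zero, neg_zero, Real.exp_zero, Complex.ofReal_one, mul_one]
    have hIk : 2 * Complex.I * k = -2 * κ := by
      rw [hk]; linear_combination (2 * (κ:ℂ)) * Complex.I_sq
    rw [hIk]
    push_cast; ring
  rw [hWL, hW0] at hconst
  rcases mul_eq_zero.1 hconst with hu0 | hA
  · exfalso
    have hu0 : u 0 = 0 := by exact_mod_cast hu0
    have hu10 : deriv u 0 = 0 := by rw [h0, hu0, mul_zero]
    obtain ⟨B, hB⟩ := (isCompact_Icc (a := (0:ℝ)) (b := L)).exists_bound_of_continuousOn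
      (f := V) h.contV.continuousOn
    have hB0 : 0 ≤ B := (norm_nonneg _).trans (hB 0 ⟨le_rfl, h.hL.le⟩)
    have hVB : ∀ x, |V x| ≤ B := by
      intro x
      by_cases hx : x ∈ Icc 0 L
      · exact hB x hx
      · rw [h.hs x hx]; simpa using hB0
    obtain ⟨x, hx⟩ := hne
    apply hx
    have := (ode_zero (fun x => ((V x + κ ^ 2 : ℝ) : ℂ)) (B + κ ^ 2) (fun x => by
        rw [Complex.norm_real, Real.norm_eq_abs]
        refine (abs_add_le _ _).trans ?_
        rw [abs_of_nonneg (sq_nonneg κ)]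
        linarith [hVB x])
      (fun x => (u x : ℂ)) (fun x => ((deriv u x : ℝ) : ℂ)) (fun x => (du x).ofReal_comp)
      (fun x => ((du1 x).ofReal_comp).congr_deriv (by push_cast; ring)) 0
      (by simp [hu0]) (by simp [hu10]) x).1
    exact_mod_cast this
  · simpa using hA

end IsJost


namespace IsJost
variable {V : ℝ → ℝ} {L : ℝ} {m p : ℂ → ℝ → ℂ}

lemma a_eq (h : IsJost V L m p) (k : ℝ) (hk : k ≠ 0) (f : ℝ → ℂ) (a b : ℂ)
    (hf2 : ContDiff ℝ 2 f)
    (hode : ∀ x : ℝ, -(deriv (deriv f) x) + (V x : ℂ) * f x = ((k : ℂ) ^ 2) * f x)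
    (hr : ∀ x ≥ L, f x = Complex.exp (Complex.I * k * x))
    (hl : ∀ x ≤ (0 : ℝ), f x = a * Complex.exp (Complex.I * k * x) +
          b * Complex.exp (-(Complex.I * k * x))) : a = jA m p k / k := by
  have hkc : (k:ℂ) ≠ 0 := by exact_mod_cast hk
  have de : ∀ x : ℝ, HasDerivAt (fun x : ℝ => Complex.exp (Complex.I * k * x))
      (Complex.exp (Complex.I * k * x) * (Complex.I * k)) x := by
    intro x
    have h1 : HasDerivAt (fun x : ℝ => Complex.I * k * (x:ℂ)) (Complex.I * k) x :=
      (((hasDerivAt_id x).ofReal_comp).const_mul (Complex.I * k)).congr_deriv (by simp)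
    exact h1.cexp
  have de' : ∀ x : ℝ, HasDerivAt (fun x : ℝ => Complex.exp (-(Complex.I * k * x)))
      (Complex.exp (-(Complex.I * k * x)) * (-(Complex.I * k))) x := by
    intro x
    have h1 : HasDerivAt (fun x : ℝ => Complex.I * k * (x:ℂ)) (Complex.I * k) x :=
      (((hasDerivAt_id x).ofReal_comp).const_mul (Complex.I * k)).congr_deriv (by simp)
    exact h1.neg.cexp
  have df : ∀ x, HasDerivAt f (deriv f x) x := fun x =>
    (hf2.differentiable (by norm_num) x).hasDerivAt
  have df1 : ∀ x, HasDerivAt (deriv f) (((V x - k ^ 2 : ℝ) : ℂ) * f x) x := fun x => by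
    refine (hf2.differentiable_deriv_two x).hasDerivAt.congr_deriv ?_
    have := hode x
    push_cast
    linear_combination -this
  set y : ℝ → ℂ := fun x => m k x * Complex.exp (Complex.I * k * x) with hy
  set y1 : ℝ → ℂ := fun x => (p k x + Complex.I * k * m k x) * Complex.exp (Complex.I * k * x)
    with hy1
  have dy : ∀ x, HasDerivAt y (y1 x) x := fun x => by
    refine ((h.dm k x).mul (de x)).congr_deriv ?_
    simp only [hy1]; ring
  have dy1 : ∀ x, HasDerivAt y1 (((V x - k ^ 2 : ℝ) : ℂ) * y x) x := fun x => by
    refine (((h.dp k x).add ((h.dm k x).const_mul (Complex.I * k))).mul (de x)).congr_deriv ?_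
    simp only [hy, Pi.add_apply]
    push_cast
    linear_combination ((k:ℂ) ^ 2 * m k x * Complex.exp (Complex.I * k * x)) * Complex.I_sq
  obtain ⟨B, hB⟩ := (isCompact_Icc (a := (0:ℝ)) (b := L)).exists_bound_of_continuousOn
    (f := V) h.contV.continuousOn
  have hB0 : 0 ≤ B := (norm_nonneg _).trans (hB 0 ⟨le_rfl, h.hL.le⟩)
  have hVB : ∀ x, |V x| ≤ B := by
    intro x
    by_cases hx : x ∈ Icc 0 L
    · exact hB x hx
    · rw [h.hs x hx]; simpa using hB0
  have hend := h.hend k (L + 1) (by linarith)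
  have z0 : f (L + 1) - y (L + 1) = 0 := by
    simp only [hy]
    rw [hr (L + 1) (by linarith), hend.1]; ring
  have z1 : deriv f (L + 1) - y1 (L + 1) = 0 := by
    have heq : f =ᶠ[nhds (L + 1)] fun x : ℝ => Complex.exp (Complex.I * k * x) := by
      filter_upwards [Ioi_mem_nhds (by linarith : L < L + 1)] with x hx
      exact hr x (le_of_lt hx)
    rw [heq.deriv_eq, (de (L + 1)).deriv]
    simp only [hy1]
    rw [hend.1, hend.2]; ring
  have hz := ode_zero (fun x => ((V x - k ^ 2 : ℝ) : ℂ)) (B + k ^ 2) (fun x => by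
      rw [Complex.norm_real, Real.norm_eq_abs]
      refine (abs_sub _ _).trans ?_
      rw [abs_of_nonneg (sq_nonneg k)]
      linarith [hVB x])
    (fun x => f x - y x) (fun x => deriv f x - y1 x) (fun x => (df x).sub (dy x))
    (fun x => ((df1 x).sub (dy1 x)).congr_deriv (by ring)) (L + 1) z0 z1 0
  have f0 : f 0 = m k 0 := by
    have := sub_eq_zero.1 hz.1
    rw [this]; simp [hy]
  have f1 : deriv f 0 = p k 0 + Complex.I * k * m k 0 := by
    have := sub_eq_zero.1 hz.2
    rw [this]; simp [hy1]
  have g0 : f 0 = a + b := by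
    rw [hl 0 le_rfl]; simp
  have g1 : deriv f 0 = a * (Complex.I * k) + b * (-(Complex.I * k)) := by
    have d1 : HasDerivWithinAt f (deriv f 0) (Iic 0) 0 := (df 0).hasDerivWithinAt
    have d2 : HasDerivWithinAt f (a * (Complex.exp (Complex.I * k * (0:ℝ)) * (Complex.I * k)) +
        b * (Complex.exp (-(Complex.I * k * (0:ℝ))) * (-(Complex.I * k)))) (Iic 0) 0 := by
      refine (((de 0).const_mul a).add ((de' 0).const_mul b)).hasDerivWithinAt.congr
        (fun x hx => ?_) ?_
      · exact hl x hx
      · exact hl 0 le_rfl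
    have := (uniqueDiffOn_Iic (0:ℝ) 0 self_mem_Iic).eq_deriv _ d1 d2
    rw [this]; simp
  have h2 := two_I_jA (m := m) (p := p) (k:ℂ)
  rw [eq_div_iff hkc]
  have hI := Complex.I_ne_zero
  have : 2 * Complex.I * (a * k) = 2 * Complex.I * jA m p k := by
    rw [h2]
    linear_combination Complex.I * k * (f0 - g0) + f1 - g1
  exact mul_left_cancel₀ (by simp) this

end IsJost

theorem sum_rule
    (V : ℝ → ℝ) (L : ℝ) (hV : ContDiff ℝ (⊤ : ℕ∞) V)
    (hsupp : Function.support V ⊆ Icc 0 L)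
    (f : ℝ → ℝ → ℂ) (a b : ℝ → ℂ)
    (hf : ∀ k : ℝ, k ≠ 0 →
      ContDiff ℝ 2 (f k) ∧
      (∀ x : ℝ, -(deriv (deriv (f k)) x) + (V x : ℂ) * f k x = ((k : ℂ) ^ 2) * f k x) ∧
      (∀ x ≥ L, f k x = Complex.exp (Complex.I * k * x)) ∧
      (∀ x ≤ (0 : ℝ),
        f k x = a k * Complex.exp (Complex.I * k * x) +
          b k * Complex.exp (-(Complex.I * k * x))))
    (S : Set ℝ)
    (hS : S = {E : ℝ | E < 0 ∧ ∃ u : ℝ → ℝ,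
      ContDiff ℝ 2 u ∧ (∃ x : ℝ, u x ≠ 0) ∧
      (∀ x : ℝ, -(deriv (deriv u) x) + V x * u x = E * u x) ∧
      Integrable (fun x => u x ^ 2)}) :
    Integrable (fun k : ℝ => Real.log ‖a k‖ * k ^ 2) ∧
    S.Countable ∧
    Summable (fun E : S => |(E : ℝ)| ^ ((3 : ℝ) / 2)) ∧
    Integrable (fun x : ℝ => V x ^ 2) ∧
    (∫ k : ℝ, Real.log ‖a k‖ * k ^ 2) +
        (2 * π / 3) * (∑' E : S, |(E : ℝ)| ^ ((3 : ℝ) / 2)) =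
      (π / 8) * ∫ x : ℝ, V x ^ 2 := by
  have hVc : Continuous V := hV.continuous
  set L' := max L 1 with hL'
  have hLL : L ≤ L' := le_max_left _ _
  have hs : ∀ x, x ∉ Icc 0 L' → V x = 0 := by
    intro x hx
    by_contra hne
    have := hsupp (Function.mem_support.2 hne)
    exact hx ⟨this.1, this.2.trans hLL⟩
  have hL0 : 0 < L' := lt_of_lt_of_le one_pos (le_max_right _ _)
  obtain ⟨m, p, h1, h2, h3, h4, h5⟩ := jost_exists V hVc L' hL0 hs
  have h : IsJost V L' m p := ⟨hVc, hL0, hs, h1, h2, h3, h4, h5⟩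
  have hfun : (fun k : ℝ => Real.log ‖a k‖ * k ^ 2) = IsJost.jg m p := by
    funext k
    by_cases hk : k = 0
    · simp [IsJost.jg, hk]
    · obtain ⟨q1, q2, q3, q4⟩ := hf k hk
      rw [IsJost.jg, ← h.a_eq k hk (f k) (a k) (b k) q1 q2 (fun x hx => q3 x (hLL.trans hx)) q4]
  obtain ⟨Z, hZ, hre, hsum⟩ := h.sum_rule_Z hV _ rfl
  have hP : ∫ x : ℝ, V x ^ 2 = ∫ x in (0:ℝ)..(L'+1), V x ^ 2 := by
    refine (intervalIntegral.integral_eq_integral_of_support_subset ?_).symm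
    intro x hx
    have hVx : V x ≠ 0 := fun h0 => hx (by simp [h0])
    have hmem : x ∈ Icc 0 L' := by
      by_contra hn; exact hVx (hs x hn)
    refine ⟨lt_of_le_of_ne hmem.1 ?_, by linarith [hmem.2]⟩
    rintro rfl
    exact hVx h.V_zero
  have hVi : Integrable (fun x : ℝ => V x ^ 2) := by
    refine (hVc.pow 2).integrable_of_hasCompactSupport ?_
    exact HasCompactSupport.intro (isCompact_Icc (a := (0:ℝ)) (b := L')) fun x hx => by
      simp [hs x hx]
  classical
  set T : Finset ℝ := (Z.filter (fun z => z.im ≠ 0)).image (fun z => - z.im ^ 2) with hT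
  have hST : S = (T : Set ℝ) := by
    ext E
    rw [hS, hT, Finset.coe_image, mem_image, mem_setOf_eq]
    constructor
    · rintro ⟨hE, u, hu, hne, hode, hintg⟩
      have hκ : 0 < √(-E) := Real.sqrt_pos.2 (by linarith)
      have hE2 : E = -(√(-E)) ^ 2 := by rw [Real.sq_sqrt (by linarith)]; ring
      have hz := h.zero_of_eig E (√(-E)) hκ hE2 u hu hne hode hintg
      refine ⟨(√(-E) : ℝ) * Complex.I, ?_, ?_⟩
      · rw [Finset.mem_coe, Finset.mem_filter, hZ]
        refine ⟨⟨?_, hz⟩, ?_⟩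
        · simpa using hκ.le
        · simpa using hκ.ne'
      · simpa using hE2.symm
    · rintro ⟨z, hz, rfl⟩
      rw [Finset.mem_coe, Finset.mem_filter] at hz
      obtain ⟨hzZ, him⟩ := hz
      have hz2 := (hZ z).1 hzZ
      have hpos : 0 < z.im := lt_of_le_of_ne hz2.1 (Ne.symm him)
      have hzz : z = (z.im : ℂ) * Complex.I := by
        apply Complex.ext <;> simp [hre z hzZ]
      refine ⟨by nlinarith, ?_⟩
      exact h.eig_of_zero _ z.im hpos rfl (by rw [← hzz]; exact hz2.2)
  have hfin : S.Finite := hST ▸ T.finite_toSet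
  have hts : ∑' E : S, |(E : ℝ)| ^ ((3 : ℝ) / 2) = ∑ z ∈ Z, z.im ^ 3 := by
    rw [hST, Finset.tsum_subtype' T (fun E : ℝ => |E| ^ ((3:ℝ)/2)), hT, Finset.sum_image]
    · rw [← Finset.sum_filter_of_ne (p := fun z : ℂ => z.im ≠ 0) (s := Z)]
      · refine Finset.sum_congr rfl fun z hz => ?_
        have h0 := ((hZ z).1 (Finset.mem_filter.1 hz).1).1
        rw [abs_neg, abs_of_nonneg (sq_nonneg _), ← Real.rpow_natCast, ← Real.rpow_mul h0,
          ← Real.rpow_natCast]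
        norm_num
      · intro z _ hne h0
        exact hne (by rw [h0]; simp)
    · intro z hz w hw hzw
      have hz' := (Finset.mem_filter.1 hz).1
      have hw' := (Finset.mem_filter.1 hw).1
      have e : z.im ^ 2 = w.im ^ 2 := neg_injective hzw
      have e2 : z.im = w.im := by
        have := (sq_eq_sq₀ ((hZ z).1 hz').1 ((hZ w).1 hw').1).1 e
        exact this
      exact Complex.ext (by rw [hre z hz', hre w hw']) e2
  have : Finite S := hfin
  refine ⟨by rw [hfun]; exact h.jg_integrable hV, hfin.countable, Summable.of_finite, hVi, ?_⟩
  rw [hfun, hts, hP]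
  exact hsum
end

section
/- For every d ≥ 2 there exist a measurable potential V : ℝ^d → ℝ, a constant C > 0, an energy E > 0, and a nonzero u ∈ L²(ℝ^d) with V·u locally integrable, such that |V(x)| ≤ C·(|x₁| + x₂² + ⋯ + x_d²)^{−1} for all x = (x₁,…,x_d) ≠ 0, and u satisfies −Δu + Vu = Eu in the distributional sense: for every smooth compactly supported φ : ℝ^d → ℂ, ∫_{ℝ^d} u·Δφ dx = ∫_{ℝ^d} (V(x) − E)·u·φ dx. -/
open Real Set MeasureTheory

/-- The Laplacian of `φ : ℝ^d → ℂ`, as the sum of second directional derivatives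
along the standard basis. -/
noncomputable def laplacian {d : ℕ} (φ : EuclideanSpace ℝ (Fin d) → ℂ)
    (x : EuclideanSpace ℝ (Fin d)) : ℂ :=
  ∑ i : Fin d,
    fderiv ℝ (fun y => fderiv ℝ φ y (EuclideanSpace.single i 1)) x
      (EuclideanSpace.single i 1)

/-- The phase-like function of the Wigner–von Neumann construction. -/
noncomputable def wvG (a : ℝ) : ℝ := 2 * a - sin (2 * a)

noncomputable def wvQ (a s : ℝ) : ℝ := 1 + wvG a ^ 2 + s ^ 2

noncomputable def wvH (N : ℕ) (a s : ℝ) : ℝ := sin a / wvQ a s ^ N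

noncomputable def wvHa (N : ℕ) (a s : ℝ) : ℝ :=
  cos a / wvQ a s ^ N - 8 * N * wvG a * sin a ^ 3 / wvQ a s ^ (N + 1)

noncomputable def wvV0 (N : ℕ) (a s : ℝ) : ℝ :=
  - 32 * N * (wvG a * sin a * cos a / wvQ a s) - 32 * N * (sin a ^ 4 / wvQ a s)
    + 64 * N * (N + 1) * (wvG a ^ 2 * sin a ^ 4 / wvQ a s ^ 2)

noncomputable def wvHs (N : ℕ) (a s : ℝ) : ℝ :=
  - 2 * N * s * sin a / wvQ a s ^ (N + 1)

noncomputable def wvHss (N : ℕ) (a s : ℝ) : ℝ :=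
  sin a * (- 2 * N / wvQ a s ^ (N + 1) + 4 * N * (N + 1) * s ^ 2 / wvQ a s ^ (N + 2))

noncomputable def wvV1 (N d : ℕ) (a s : ℝ) : ℝ :=
  - 8 * N * (s / wvQ a s) + 16 * N * (N + 1) * (s ^ 3 / wvQ a s ^ 2)
    - 4 * N * (d - 1) * (s / wvQ a s)

lemma wvQ_one_le (a s : ℝ) : 1 ≤ wvQ a s := by
  unfold wvQ; nlinarith [sq_nonneg (wvG a), sq_nonneg s]

lemma wvQ_pos (a s : ℝ) : 0 < wvQ a s := lt_of_lt_of_le one_pos (wvQ_one_le a s)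

lemma wvQ_ne (a s : ℝ) : wvQ a s ≠ 0 := (wvQ_pos a s).ne'

lemma wvG_hasDerivAt (a : ℝ) : HasDerivAt wvG (4 * sin a ^ 2) a := by
  have h1 : HasDerivAt (fun a : ℝ => 2 * a) 2 a := by
    simpa using (hasDerivAt_id a).const_mul 2
  have h := h1.sub h1.sin
  refine h.congr_deriv ?_
  rw [cos_two_mul, cos_sq']; ring

lemma wvQ_hasDerivAt_a (a s : ℝ) :
    HasDerivAt (fun a => wvQ a s) (8 * wvG a * sin a ^ 2) a := by
  have h := (((wvG_hasDerivAt a).pow 2).const_add 1).add_const (s ^ 2)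
  refine h.congr_deriv ?_
  norm_num; ring

lemma wvQ_hasDerivAt_s (a s : ℝ) :
    HasDerivAt (fun s => wvQ a s) (2 * s) s := by
  have h := ((hasDerivAt_id s).pow 2).const_add (1 + wvG a ^ 2)
  refine h.congr_deriv ?_
  simp

/-- derivative of a quotient by a power, in a convenient form -/
lemma hasDerivAt_div_pow {f q : ℝ → ℝ} {f' q' x : ℝ} (hf : HasDerivAt f f' x)
    (hq : HasDerivAt q q' x) (hne : q x ≠ 0) (n : ℕ) :
    HasDerivAt (fun y => f y / q y ^ n)
      (f' / q x ^ n - n * f x * q' / q x ^ (n + 1)) x := by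
  refine (hf.div (hq.pow n) (pow_ne_zero n hne)).congr_deriv ?_
  simp only [Pi.pow_apply]
  cases n with
  | zero => simp
  | succ n =>
    simp only [Nat.add_sub_cancel]
    field_simp
    ring

lemma wvH_hasDerivAt_a (N : ℕ) (a s : ℝ) :
    HasDerivAt (fun a => wvH N a s) (wvHa N a s) a := by
  refine (hasDerivAt_div_pow (hasDerivAt_sin a) (wvQ_hasDerivAt_a a s) (wvQ_ne a s) N).congr_deriv ?_
  unfold wvHa; ring

lemma wvHa_hasDerivAt_a (N : ℕ) (a s : ℝ) :
    HasDerivAt (fun a => wvHa N a s) ((wvV0 N a s - 1) * wvH N a s) a := by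
  have h1 := hasDerivAt_div_pow (hasDerivAt_cos a) (wvQ_hasDerivAt_a a s) (wvQ_ne a s) N
  have h2 := hasDerivAt_div_pow (((wvG_hasDerivAt a).const_mul (8 * (N : ℝ))).mul
    ((hasDerivAt_sin a).pow 3)) (wvQ_hasDerivAt_a a s) (wvQ_ne a s) (N + 1)
  refine (h1.sub h2).congr_deriv ?_
  have := wvQ_ne a s
  unfold wvV0 wvH
  simp only [Pi.mul_apply, Pi.pow_apply]
  push_cast
  field_simp
  ring

lemma wvH_hasDerivAt_s (N : ℕ) (a s : ℝ) :
    HasDerivAt (fun s => wvH N a s) (wvHs N a s) s := by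
  refine (hasDerivAt_div_pow (hasDerivAt_const s (sin a)) (wvQ_hasDerivAt_s a s)
    (wvQ_ne a s) N).congr_deriv ?_
  unfold wvHs; ring

lemma wvHs_hasDerivAt_s (N : ℕ) (a s : ℝ) :
    HasDerivAt (fun s => wvHs N a s) (wvHss N a s) s := by
  refine (hasDerivAt_div_pow (((hasDerivAt_id s).const_mul (-2 * (N : ℝ))).mul_const (sin a))
    (wvQ_hasDerivAt_s a s) (wvQ_ne a s) (N + 1)).congr_deriv ?_
  have := wvQ_ne a s
  unfold wvHss
  simp only [id]
  push_cast
  field_simp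
  ring

lemma wv_sum_s (N d : ℕ) (a s : ℝ) :
    4 * s * wvHss N a s + 2 * (d - 1) * wvHs N a s = wvV1 N d a s * wvH N a s := by
  have := wvQ_ne a s
  unfold wvHss wvHs wvV1 wvH
  field_simp
  ring

lemma wvG_abs (a : ℝ) : 2 * |a| - 1 ≤ |wvG a| := by
  unfold wvG
  have h1 := abs_sub_abs_le_abs_sub (2 * a) (sin (2 * a))
  have h2 := abs_sin_le_one (2 * a)
  rw [abs_mul, abs_two] at h1
  linarith

lemma wv_bound (N d : ℕ) (a s : ℝ) (hs : 0 ≤ s) :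
    |wvV0 N a s + wvV1 N d a s| * (|a| + s) ≤
      3 * (64 * N + 64 * N * (N + 1) + 8 * N + 16 * N * (N + 1) + 4 * N * (d + 1)) := by
  set R := |wvG a| + 1 + s with hR
  have hg := abs_nonneg (wvG a)
  have hQ := wvQ_pos a s
  have hQ1 := wvQ_one_le a s
  have hrR : |a| + s ≤ R := by linarith [wvG_abs a, abs_nonneg a]
  have hR1 : 1 ≤ R := by linarith
  have hQe : wvQ a s = 1 + |wvG a| ^ 2 + s ^ 2 := by rw [sq_abs]; rfl
  have hRQ : R * R ≤ 3 * wvQ a s := by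
    rw [hQe, hR]
    nlinarith [sq_nonneg (|wvG a| - 1), sq_nonneg (|wvG a| - s), sq_nonneg (s - 1)]
  have hs1 := abs_sin_le_one a
  have hc1 := abs_cos_le_one a
  have hs4 : |sin a| ^ 4 ≤ 1 := pow_le_one₀ (abs_nonneg _) hs1
  -- a general bounding principle
  have key : ∀ m : ℝ, |m| ≤ R → |m / wvQ a s| * R ≤ 3 := by
    intro m hm
    rw [abs_div, abs_of_pos hQ, div_mul_eq_mul_div, div_le_iff₀ hQ]
    nlinarith
  have t1 : |wvG a * sin a * cos a / wvQ a s| * R ≤ 3 := by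
    apply key
    rw [abs_mul, abs_mul]
    have h1 : |wvG a| * |sin a| ≤ |wvG a| * 1 := by gcongr
    have h2 : |wvG a| * |sin a| * |cos a| ≤ |wvG a| * |sin a| * 1 := by gcongr
    linarith
  have t2 : |sin a ^ 4 / wvQ a s| * R ≤ 3 := by
    apply key; rw [abs_pow]; linarith
  have t3 : |wvG a ^ 2 * sin a ^ 4 / wvQ a s ^ 2| * R ≤ 3 := by
    have : wvG a ^ 2 * sin a ^ 4 / wvQ a s ^ 2
        = (wvG a ^ 2 * sin a ^ 4 / wvQ a s) / wvQ a s := by field_simp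
    rw [this]
    apply key
    rw [abs_div, abs_of_pos hQ, div_le_iff₀ hQ, abs_mul, abs_pow, abs_pow]
    have h2 : |wvG a| ^ 2 * |sin a| ^ 4 ≤ |wvG a| ^ 2 * 1 := by gcongr
    nlinarith [sq_nonneg s]
  have t4 : |s / wvQ a s| * R ≤ 3 := by
    apply key; rw [abs_of_nonneg hs]; linarith
  have t5 : |s ^ 3 / wvQ a s ^ 2| * R ≤ 3 := by
    have : s ^ 3 / wvQ a s ^ 2 = (s ^ 3 / wvQ a s) / wvQ a s := by field_simp
    rw [this]
    apply key
    rw [abs_div, abs_of_pos hQ, div_le_iff₀ hQ, abs_pow, abs_of_nonneg hs]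
    have h2 : s ^ 2 ≤ wvQ a s := by rw [hQe]; nlinarith
    have h3 : s ≤ R := by linarith
    calc s ^ 3 = s * s ^ 2 := by ring
      _ ≤ R * wvQ a s := by gcongr
  have hN : (0 : ℝ) ≤ N := Nat.cast_nonneg N
  have hd : (0 : ℝ) ≤ d := Nat.cast_nonneg d
  have hd1 : |(d : ℝ) - 1| ≤ d + 1 := by rw [abs_le]; constructor <;> linarith
  have step : |wvV0 N a s + wvV1 N d a s| ≤
      32 * N * |wvG a * sin a * cos a / wvQ a s| + 32 * N * |sin a ^ 4 / wvQ a s|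
      + 64 * N * (N + 1) * |wvG a ^ 2 * sin a ^ 4 / wvQ a s ^ 2|
      + 8 * N * |s / wvQ a s| + 16 * N * (N + 1) * |s ^ 3 / wvQ a s ^ 2|
      + 4 * N * (d + 1) * |s / wvQ a s| := by
    unfold wvV0 wvV1
    generalize wvG a * sin a * cos a / wvQ a s = y1
    generalize sin a ^ 4 / wvQ a s = y2
    generalize wvG a ^ 2 * sin a ^ 4 / wvQ a s ^ 2 = y3
    generalize hy4 : s / wvQ a s = y4
    generalize s ^ 3 / wvQ a s ^ 2 = y5
    have b : ∀ c y : ℝ, 0 ≤ c → -(c * |y|) ≤ c * y ∧ c * y ≤ c * |y| := by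
      intro c y hc
      constructor
      · nlinarith [neg_abs_le y]
      · nlinarith [le_abs_self y]
    have b1 := b (32 * N) y1 (by positivity)
    have b2 := b (32 * N) y2 (by positivity)
    have b3 := b (64 * N * (N + 1)) y3 (by positivity)
    have b4 := b (8 * N) y4 (by positivity)
    have b5 := b (16 * N * (N + 1)) y5 (by positivity)
    have b6 : |4 * N * (d - 1) * y4| ≤ 4 * N * (d + 1) * |y4| := by
      rw [abs_mul, abs_mul, abs_of_nonneg (by positivity : (0 : ℝ) ≤ 4 * N)]
      gcongr
    rw [abs_le] at b6 ⊢
    constructor <;> linarith [b1.1, b1.2, b2.1, b2.2, b3.1, b3.2, b4.1, b4.2, b5.1, b5.2, b6.1, b6.2]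
  have f1 := mul_le_mul_of_nonneg_left t1 (by positivity : (0 : ℝ) ≤ 32 * N)
  have f2 := mul_le_mul_of_nonneg_left t2 (by positivity : (0 : ℝ) ≤ 32 * N)
  have f3 := mul_le_mul_of_nonneg_left t3 (by positivity : (0 : ℝ) ≤ 64 * N * (N + 1))
  have f4 := mul_le_mul_of_nonneg_left t4 (by positivity : (0 : ℝ) ≤ 8 * N)
  have f5 := mul_le_mul_of_nonneg_left t5 (by positivity : (0 : ℝ) ≤ 16 * N * (N + 1))
  have f6 := mul_le_mul_of_nonneg_left t4 (by positivity : (0 : ℝ) ≤ 4 * N * (d + 1))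
  calc |wvV0 N a s + wvV1 N d a s| * (|a| + s) ≤ |wvV0 N a s + wvV1 N d a s| * R := by gcongr
    _ ≤ _ := mul_le_mul_of_nonneg_right step (by linarith)
    _ ≤ _ := by linarith

lemma wvQ_lower (a s : ℝ) : 1 + (a ^ 2 + s) ≤ 2 * wvQ a s := by
  have h := wvG_abs a
  have h2 : |a| ^ 2 ≤ ((|wvG a| + 1) / 2) ^ 2 := by
    apply pow_le_pow_left₀ (abs_nonneg _); linarith
  have hQe : wvQ a s = 1 + |wvG a| ^ 2 + s ^ 2 := by rw [sq_abs]; rfl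
  rw [sq_abs] at h2
  rw [hQe]
  nlinarith [sq_nonneg (|wvG a| - 1), sq_nonneg (s - 1)]

section multi

variable {d : ℕ}

/-- sum of squares of the other coordinates -/
noncomputable def wvS (z : Fin d) (x : EuclideanSpace ℝ (Fin d)) : ℝ :=
  ∑ i ∈ Finset.univ.erase z, x i ^ 2

lemma wvS_nonneg (z : Fin d) (x : EuclideanSpace ℝ (Fin d)) : 0 ≤ wvS z x :=
  Finset.sum_nonneg fun _ _ => sq_nonneg _

lemma wv_norm_sq (z : Fin d) (x : EuclideanSpace ℝ (Fin d)) : ‖x‖ ^ 2 = x z ^ 2 + wvS z x := by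
  rw [EuclideanSpace.real_norm_sq_eq, wvS, Finset.add_sum_erase _ (fun i => x i ^ 2) (Finset.mem_univ z)]

lemma wvS_line_z (z : Fin d) (x : EuclideanSpace ℝ (Fin d)) (t : ℝ) :
    wvS z (x + t • EuclideanSpace.single z 1) = wvS z x := by
  unfold wvS
  refine Finset.sum_congr rfl fun i hi => ?_
  have : i ≠ z := Finset.ne_of_mem_erase hi
  simp [this]

lemma wvS_line_i (z i : Fin d) (hi : i ≠ z) (x : EuclideanSpace ℝ (Fin d)) (t : ℝ) :
    wvS z (x + t • EuclideanSpace.single i 1) = wvS z x + (2 * x i * t + t ^ 2) := by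
  unfold wvS
  have hm : i ∈ Finset.univ.erase z := by simp [hi]
  rw [← Finset.add_sum_erase _ _ hm, ← Finset.add_sum_erase _ (fun i => x i ^ 2) hm]
  have : ∑ j ∈ (Finset.univ.erase z).erase i,
      (x + t • EuclideanSpace.single i (1 : ℝ)) j ^ 2 =
      ∑ j ∈ (Finset.univ.erase z).erase i, x j ^ 2 := by
    refine Finset.sum_congr rfl fun j hj => ?_
    have : j ≠ i := Finset.ne_of_mem_erase hj
    simp [this]
  rw [this]
  simp
  ring

/-- first directional derivatives -/
noncomputable def wvA (N : ℕ) (z i : Fin d) (x : EuclideanSpace ℝ (Fin d)) : ℝ :=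
  if i = z then wvHa N (x z) (wvS z x) else 2 * x i * wvHs N (x z) (wvS z x)

/-- second directional derivatives -/
noncomputable def wvB (N : ℕ) (z i : Fin d) (x : EuclideanSpace ℝ (Fin d)) : ℝ :=
  if i = z then (wvV0 N (x z) (wvS z x) - 1) * wvH N (x z) (wvS z x)
  else 2 * wvHs N (x z) (wvS z x) + 4 * x i ^ 2 * wvHss N (x z) (wvS z x)

lemma hasDerivAt_line_z {f : ℝ → ℝ} {f' a : ℝ} (h : HasDerivAt f f' a) :
    HasDerivAt (fun t => f (a + t)) f' 0 := by
  have : HasDerivAt f f' (a + 0) := by simpa using h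
  simpa using this.comp_const_add a 0

lemma hasDerivAt_line_i {f : ℝ → ℝ} {f' s : ℝ} (h : HasDerivAt f f' s) (c : ℝ) :
    HasDerivAt (fun t => f (s + (2 * c * t + t ^ 2))) (f' * (2 * c)) 0 := by
  have h1 : HasDerivAt (fun t : ℝ => s + (2 * c * t + t ^ 2)) (2 * c) 0 := by
    have := (((hasDerivAt_id (0 : ℝ)).const_mul (2 * c)).add
      ((hasDerivAt_id (0 : ℝ)).pow 2)).const_add s
    refine this.congr_deriv ?_
    simp
  have h2 : HasDerivAt f f' (s + (2 * c * 0 + 0 ^ 2)) := by simpa using h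
  exact HasDerivAt.comp (0 : ℝ) h2 h1

lemma wvU_line (N : ℕ) (z i : Fin d) (x : EuclideanSpace ℝ (Fin d)) :
    HasLineDerivAt ℝ (fun x : EuclideanSpace ℝ (Fin d) => wvH N (x z) (wvS z x)) (wvA N z i x) x
      (EuclideanSpace.single i 1) := by
  unfold HasLineDerivAt wvA
  by_cases hi : i = z
  · subst hi
    simp only [wvS_line_z, if_true]
    simpa using hasDerivAt_line_z (wvH_hasDerivAt_a N (x i) (wvS i x))
  · simp only [wvS_line_i z i hi, if_neg hi]
    have h := hasDerivAt_line_i (wvH_hasDerivAt_s N (x z) (wvS z x)) (x i)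
    have hz : z ≠ i := fun h => hi h.symm
    simp only [PiLp.add_apply, PiLp.smul_apply, PiLp.single_apply, hz, if_false, smul_zero, add_zero]
    exact h.congr_deriv (by ring)

lemma wvA_line (N : ℕ) (z i : Fin d) (x : EuclideanSpace ℝ (Fin d)) :
    HasLineDerivAt ℝ (wvA N z i) (wvB N z i x) x
      (EuclideanSpace.single i 1) := by
  unfold HasLineDerivAt wvB wvA
  by_cases hi : i = z
  · subst hi
    simp only [wvS_line_z, if_true]
    simpa using hasDerivAt_line_z (wvHa_hasDerivAt_a N (x i) (wvS i x))
  · simp only [wvS_line_i z i hi, if_neg hi]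
    have h := hasDerivAt_line_i (wvHs_hasDerivAt_s N (x z) (wvS z x)) (x i)
    have hz : z ≠ i := fun h => hi h.symm
    have h3 : HasDerivAt (fun t : ℝ => 2 * (x i + t)) 2 0 := by
      simpa using ((hasDerivAt_id (0 : ℝ)).const_add (x i)).const_mul 2
    simp only [PiLp.add_apply, PiLp.smul_apply, PiLp.single_apply, hz, if_false, if_true, smul_eq_mul,
      mul_one, mul_zero, add_zero]
    refine (h3.mul h).congr_deriv ?_
    simp; ring

lemma wvB_sum (N : ℕ) (z : Fin d) (x : EuclideanSpace ℝ (Fin d)) :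
    ∑ i, wvB N z i x = (wvV0 N (x z) (wvS z x) + wvV1 N d (x z) (wvS z x) - 1)
      * wvH N (x z) (wvS z x) := by
  rw [← Finset.add_sum_erase _ _ (Finset.mem_univ z)]
  have : ∑ i ∈ Finset.univ.erase z, wvB N z i x =
      ∑ i ∈ Finset.univ.erase z, (2 * wvHs N (x z) (wvS z x)
        + 4 * x i ^ 2 * wvHss N (x z) (wvS z x)) := by
    refine Finset.sum_congr rfl fun i hi => ?_
    simp [wvB, Finset.ne_of_mem_erase hi]
  rw [this, Finset.sum_add_distrib, Finset.sum_const, ← Finset.sum_mul, ← Finset.mul_sum]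
  have hc : (((Finset.univ.erase z).card : ℕ) : ℝ) = d - 1 := by
    rw [Finset.card_erase_of_mem (Finset.mem_univ z), Finset.card_univ, Fintype.card_fin,
      Nat.cast_sub (by have := z.pos; omega)]
    simp
  rw [nsmul_eq_mul, hc]
  change wvB N z z x + ((d - 1) * (2 * wvHs N (x z) (wvS z x))
    + 4 * wvS z x * wvHss N (x z) (wvS z x)) = _
  have h := wv_sum_s N d (x z) (wvS z x)
  simp only [wvB, if_true]
  linear_combination h

lemma wvG_cont : Continuous wvG := by unfold wvG; fun_prop

lemma wvQ_cont {X : Type*} [TopologicalSpace X] {f g : X → ℝ} (hf : Continuous f)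
    (hg : Continuous g) : Continuous fun x => wvQ (f x) (g x) := by
  unfold wvQ
  have := wvG_cont.comp hf
  simp only [Function.comp_def] at this
  fun_prop

lemma wvS_cont (z : Fin d) : Continuous (wvS z) := by unfold wvS; fun_prop

lemma wv_cont (N : ℕ) (z : Fin d) :
    Continuous (fun x : EuclideanSpace ℝ (Fin d) => wvH N (x z) (wvS z x)) ∧
    Continuous (fun x : EuclideanSpace ℝ (Fin d) => wvHa N (x z) (wvS z x)) ∧
    Continuous (fun x : EuclideanSpace ℝ (Fin d) => wvHs N (x z) (wvS z x)) ∧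
    Continuous (fun x : EuclideanSpace ℝ (Fin d) => wvHss N (x z) (wvS z x)) ∧
    Continuous (fun x : EuclideanSpace ℝ (Fin d) => wvV0 N (x z) (wvS z x)) ∧
    Continuous (fun x : EuclideanSpace ℝ (Fin d) => wvV1 N d (x z) (wvS z x)) := by
  have hz : Continuous (fun x : EuclideanSpace ℝ (Fin d) => x z) := by fun_prop
  have hS := wvS_cont z
  have hQ := wvQ_cont hz hS
  have hG : Continuous (fun x : EuclideanSpace ℝ (Fin d) => wvG (x z)) := wvG_cont.comp hz
  have hne : ∀ n : ℕ, ∀ x : EuclideanSpace ℝ (Fin d), wvQ (x z) (wvS z x) ^ n ≠ 0 :=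
    fun n x => pow_ne_zero n (wvQ_ne _ _)
  have hne1 : ∀ x : EuclideanSpace ℝ (Fin d), wvQ (x z) (wvS z x) ≠ 0 :=
    fun x => (wvQ_ne _ _)
  unfold wvH wvHa wvHs wvHss wvV0 wvV1
  refine ⟨?_, ?_, ?_, ?_, ?_, ?_⟩ <;> fun_prop (disch := first | exact hne _ | exact hne1 | (intro x; exact hne _ x) | exact hne _ _ | exact hne1 _)

lemma wvA_cont (N : ℕ) (z i : Fin d) : Continuous (wvA N z i) := by
  obtain ⟨h1, h2, h3, h4, h5, h6⟩ := wv_cont N z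
  unfold wvA
  split_ifs <;> fun_prop

lemma wvB_cont (N : ℕ) (z i : Fin d) : Continuous (wvB N z i) := by
  obtain ⟨h1, h2, h3, h4, h5, h6⟩ := wv_cont N z
  unfold wvB
  split_ifs <;> fun_prop

lemma line_ofReal {f : EuclideanSpace ℝ (Fin d) → ℝ} {f' : ℝ} {x v : EuclideanSpace ℝ (Fin d)}
    (h : HasLineDerivAt ℝ f f' x v) :
    HasLineDerivAt ℝ (fun x => (f x : ℂ)) (f' : ℂ) x v := by
  unfold HasLineDerivAt at h ⊢
  exact h.ofReal_comp

lemma wv_parts {f g : EuclideanSpace ℝ (Fin d) → ℝ} {φ : EuclideanSpace ℝ (Fin d) → ℂ}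
    (v : EuclideanSpace ℝ (Fin d))
    (hf : Continuous f) (hg : Continuous g) (hfg : ∀ x, HasLineDerivAt ℝ f (g x) x v)
    (hφ : ContDiff ℝ 1 φ) (hc : HasCompactSupport φ) :
    ∫ x, (f x : ℂ) * fderiv ℝ φ x v = - ∫ x, (g x : ℂ) * φ x := by
  have hd : Continuous (fun x => fderiv ℝ φ x v) :=
    (hφ.continuous_fderiv (by norm_num)).clm_apply continuous_const
  have hcd : HasCompactSupport (fun x => fderiv ℝ φ x v) := hc.fderiv_apply ℝ v
  have hf' : Continuous (fun x => (f x : ℂ)) := Complex.continuous_ofReal.comp hf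
  have hg' : Continuous (fun x => (g x : ℂ)) := Complex.continuous_ofReal.comp hg
  have := integral_bilinear_hasLineDerivAt_right_eq_neg_left_of_integrable
    (μ := (volume : Measure (EuclideanSpace ℝ (Fin d))))
    (f := fun x => (f x : ℂ)) (f' := fun x => (g x : ℂ)) (g := φ)
    (g' := fun x => fderiv ℝ φ x v) (v := v) (B := ContinuousLinearMap.mul ℝ ℂ)
    ?_ ?_ ?_ ?_ ?_
  · simpa using this
  · simp only [ContinuousLinearMap.mul_apply']
    exact (hg'.mul hφ.continuous).integrable_of_hasCompactSupport hc.mul_left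
  · simp only [ContinuousLinearMap.mul_apply']
    exact (hf'.mul hd).integrable_of_hasCompactSupport hcd.mul_left
  · simp only [ContinuousLinearMap.mul_apply']
    exact (hf'.mul hφ.continuous).integrable_of_hasCompactSupport hc.mul_left
  · exact fun x _ => line_ofReal (hfg x)
  · exact fun x _ => ((hφ.differentiable (by norm_num)) x).hasFDerivAt.hasLineDerivAt v

lemma wv_memLp (z : Fin d) :
    MemLp (fun x : EuclideanSpace ℝ (Fin d) => ((wvH d (x z) (wvS z x) : ℝ) : ℂ)) 2 := by
  have hcont : Continuous (fun x : EuclideanSpace ℝ (Fin d) => ((wvH d (x z) (wvS z x) : ℝ) : ℂ)) :=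
    Complex.continuous_ofReal.comp (wv_cont d z).1
  rw [memLp_two_iff_integrable_sq_norm hcont.aestronglyMeasurable]
  have hI := integrable_rpow_neg_one_add_norm_sq (E := EuclideanSpace ℝ (Fin d))
    (μ := (volume : Measure (EuclideanSpace ℝ (Fin d)))) (r := 2 * d) (by
      have : 0 < d := z.pos
      have : (0 : ℝ) < d := by exact_mod_cast this
      simp; linarith)
  refine (hI.const_mul ((2 : ℝ) ^ d)).mono' (hcont.norm.pow 2).aestronglyMeasurable ?_
  refine Filter.Eventually.of_forall fun x => ?_
  have hQ := wvQ_pos (x z) (wvS z x)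
  have hQ1 : 1 ≤ wvQ (x z) (wvS z x) ^ d := one_le_pow₀ (wvQ_one_le (x z) (wvS z x))
  have hQ2 := wvQ_lower (x z) (wvS z x)
  rw [← wv_norm_sq] at hQ2
  rw [show (-(2 * (d : ℝ)) / 2) = -(d : ℝ) by ring, rpow_neg (by positivity), rpow_natCast]
  rw [norm_pow, norm_norm, Complex.norm_real, norm_eq_abs]
  have h1 : |wvH d (x z) (wvS z x)| ≤ (wvQ (x z) (wvS z x) ^ d)⁻¹ := by
    unfold wvH
    rw [abs_div, abs_of_pos (pow_pos hQ d), div_eq_mul_inv]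
    have := abs_sin_le_one (x z)
    have h0 : 0 ≤ (wvQ (x z) (wvS z x) ^ d)⁻¹ := by positivity
    nlinarith
  have h2 : (wvQ (x z) (wvS z x) ^ d)⁻¹ ≤ 1 := inv_le_one_of_one_le₀ hQ1
  have h3 : (wvQ (x z) (wvS z x) ^ d)⁻¹ ≤ 2 ^ d * ((1 + ‖x‖ ^ 2) ^ d)⁻¹ := by
    rw [← div_eq_mul_inv, le_div_iff₀ (by positivity), inv_mul_le_iff₀ (by positivity), ← mul_pow]
    exact pow_le_pow_left₀ (by positivity) (by linarith) d
  have h4 := abs_nonneg (wvH d (x z) (wvS z x))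
  nlinarith

lemma wv_dist (N : ℕ) (z : Fin d) (φ : EuclideanSpace ℝ (Fin d) → ℂ)
    (hφ : ContDiff ℝ (⊤ : ℕ∞) φ) (hc : HasCompactSupport φ) :
    ∫ x, ((wvH N (x z) (wvS z x) : ℝ) : ℂ) * laplacian φ x =
      ∫ x, (((wvV0 N (x z) (wvS z x) + wvV1 N d (x z) (wvS z x) : ℝ) : ℂ) - ((1 : ℝ) : ℂ)) *
        ((wvH N (x z) (wvS z x) : ℝ) : ℂ) * φ x := by
  have hφ2 : ContDiff ℝ 2 φ := contDiff_infty.mp hφ 2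
  have hφ1 : ContDiff ℝ 1 φ := hφ2.of_le (by norm_num)
  have hH := (wv_cont N z).1
  have hdφ : ∀ v, ContDiff ℝ 1 (fun y => fderiv ℝ φ y v) := fun v =>
    (hφ2.fderiv_right (m := 1) (by norm_num)).clm_apply contDiff_const
  have hdc : ∀ v, HasCompactSupport (fun y => fderiv ℝ φ y v) := fun v => hc.fderiv_apply ℝ v
  have hstep : ∀ i : Fin d,
      ∫ x, ((wvH N (x z) (wvS z x) : ℝ) : ℂ) *
        fderiv ℝ (fun y => fderiv ℝ φ y (EuclideanSpace.single i 1)) x (EuclideanSpace.single i 1)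
      = ∫ x, ((wvB N z i x : ℝ) : ℂ) * φ x := by
    intro i
    rw [wv_parts (EuclideanSpace.single i 1) hH (wvA_cont N z i) (wvU_line N z i) (hdφ _) (hdc _),
      wv_parts (EuclideanSpace.single i 1) (wvA_cont N z i) (wvB_cont N z i) (wvA_line N z i) hφ1 hc,
      neg_neg]
  unfold laplacian
  simp_rw [Finset.mul_sum]
  rw [integral_finsetSum, Finset.sum_congr rfl (fun i _ => hstep i), ← integral_finsetSum]
  · congr 1
    ext x
    rw [← Finset.sum_mul, ← Complex.ofReal_sum, wvB_sum]
    push_cast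
    ring
  · intro i _
    exact ((Complex.continuous_ofReal.comp (wvB_cont N z i)).mul
      hφ.continuous).integrable_of_hasCompactSupport hc.mul_left
  · intro i _
    refine Continuous.integrable_of_hasCompactSupport ?_
      (HasCompactSupport.mul_left ((hdc _).fderiv_apply ℝ _))
    exact (Complex.continuous_ofReal.comp hH).mul
      (((hdφ _).continuous_fderiv (by norm_num)).clm_apply continuous_const)

end multi



/-- **Ionescu–Jerison multidimensional Wigner–von Neumann example.** For every
`d ≥ 2` there are a potential with `|V(x)| ≤ C(|x₁| + x₂² + ⋯ + x_d²)^{-1}`, an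
energy `E > 0` and a nonzero `u ∈ L²(ℝ^d)` solving `-Δu + V u = E u`
distributionally. -/
theorem imbedded_eigenvalue_example
    (d : ℕ) (hd : 2 ≤ d) :
    ∃ (V : EuclideanSpace ℝ (Fin d) → ℝ) (C E : ℝ)
      (u : EuclideanSpace ℝ (Fin d) → ℂ),
      Measurable V ∧ 0 < C ∧ 0 < E ∧
      (∀ x : EuclideanSpace ℝ (Fin d), x ≠ 0 →
        |V x| ≤ C * (|x ⟨0, by omega⟩| +
          ∑ i ∈ Finset.univ.erase (⟨0, by omega⟩ : Fin d), x i ^ 2)⁻¹) ∧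
      MemLp u 2 ∧ ¬ (u =ᵐ[volume] 0) ∧
      LocallyIntegrable (fun x => (V x : ℂ) * u x) ∧
      (∀ φ : EuclideanSpace ℝ (Fin d) → ℂ,
        ContDiff ℝ (⊤ : ℕ∞) φ → HasCompactSupport φ →
        ∫ x, u x * laplacian φ x = ∫ x, ((V x : ℂ) - (E : ℂ)) * u x * φ x) := by
  set z : Fin d := ⟨0, by omega⟩ with hz
  obtain ⟨hH, -, -, -, hV0, hV1⟩ := wv_cont d z
  have hV : Continuous (fun x : EuclideanSpace ℝ (Fin d) =>
      wvV0 d (x z) (wvS z x) + wvV1 d d (x z) (wvS z x)) := hV0.add hV1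
  have hu : Continuous (fun x : EuclideanSpace ℝ (Fin d) => ((wvH d (x z) (wvS z x) : ℝ) : ℂ)) :=
    Complex.continuous_ofReal.comp hH
  have hd0 : (0 : ℝ) < d := by exact_mod_cast (by omega : 0 < d)
  refine ⟨fun x => wvV0 d (x z) (wvS z x) + wvV1 d d (x z) (wvS z x),
    3 * (64 * d + 64 * d * (d + 1) + 8 * d + 16 * d * (d + 1) + 4 * d * (d + 1)), 1,
    fun x => ((wvH d (x z) (wvS z x) : ℝ) : ℂ), hV.measurable, by positivity, one_pos,
    ?_, wv_memLp z, ?_, ?_, ?_⟩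
  · intro x hx
    have hpos : 0 < |x z| + wvS z x := by
      have h0 := wvS_nonneg z x
      by_contra hle
      have h1 : |x z| = 0 := by linarith [abs_nonneg (x z)]
      have h2 : wvS z x = 0 := by linarith [abs_nonneg (x z)]
      apply hx
      have := wv_norm_sq z x
      rw [h2, abs_eq_zero.mp h1] at this
      simpa using this
    change _ ≤ _ * (|x z| + wvS z x)⁻¹
    rw [← div_eq_mul_inv, le_div_iff₀ hpos]
    exact wv_bound d d (x z) (wvS z x) (wvS_nonneg z x)
  · intro h
    have h2 := (hu.ae_eq_iff_eq volume continuous_const).mp h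
    have h3 := congrFun h2 (EuclideanSpace.single z 1)
    have h4 : wvH d ((EuclideanSpace.single z (1 : ℝ)) z) (wvS z (EuclideanSpace.single z 1)) = 0 := by
      exact Complex.ofReal_eq_zero.mp h3
    have h5 : sin 1 ≠ 0 := (sin_pos_of_pos_of_lt_pi one_pos (by linarith [pi_gt_three])).ne'
    unfold wvH at h4
    rw [div_eq_zero_iff] at h4
    rcases h4 with h4 | h4
    · apply h5
      simpa using h4
    · exact pow_ne_zero d (wvQ_ne _ _) h4
  · exact ((Complex.continuous_ofReal.comp hV).mul hu).locallyIntegrable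
  · intro φ hφ hc
    exact wv_dist d z φ hφ hc
end
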